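/- arXiv:1902.09219 — 7 statements merged into one kernel-verified Lean document; each statement's English description precedes it below -/
import Mathlib

section
/- Let n ≥ 2 and 1 ≤ p ≤ n−1. For Lebesgue almost every pair (x,y) ∈ ℝ^{(n,p)} × ℝ^{(n,p)}, the exponent of approximation satisfies e(x,y) ≥ (n−p)/p. -/
open Matrix MeasureTheory

attribute [local instance] Matrix.normedAddCommGroup

noncomputable instance matrixMeasureSpace {n p : ℕ} :
    MeasureSpace (Matrix (Fin n) (Fin p) ℝ) :=
  inferInstanceAs (MeasureSpace (Fin n → Fin p → ℝ))

/-- The exponent of approximation `e(x,y)`: the supremum of `μ ∈ ℝ` such that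
`‖γx − y‖ < ‖γ‖^{−μ}` for infinitely many `γ ∈ Γ` (integer matrices with positive
determinant). -/
noncomputable def approxExp {n p : ℕ} (x y : Matrix (Fin n) (Fin p) ℝ) : ℝ :=
  sSup {μ : ℝ | {γ : Matrix (Fin n) (Fin n) ℤ | 0 < γ.det ∧
    ‖(γ.map (Int.cast : ℤ → ℝ)) * x - y‖ < ‖γ.map (Int.cast : ℤ → ℝ)‖ ^ (-μ)}.Infinite}


namespace DN

abbrev T := UnitAddCircle
abbrev Om (m p : ℕ) := (Fin (m+p) → Fin p → T) × (Fin (m+p) → Fin p → T)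
abbrev EE (m p : ℕ) := (Fin (m+p) → Fin p → ℝ) × (Fin (m+p) → Fin p → ℝ)

instance instProbT : IsProbabilityMeasure (volume : Measure T) := ⟨by simp⟩

instance instHaarTT (m p : ℕ) : (volume : Measure (Fin m → Fin p → T)).IsAddHaarMeasure :=
  Measure.pi.isAddHaarMeasure (fun _ : Fin m => (volume : Measure (Fin p → T)))
instance instHaarRR (m p : ℕ) : (volume : Measure (Fin m → Fin p → ℝ)).IsAddHaarMeasure :=
  Measure.pi.isAddHaarMeasure (fun _ : Fin m => (volume : Measure (Fin p → ℝ)))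
instance instProbTT (m p : ℕ) : IsProbabilityMeasure (volume : Measure (Fin m → Fin p → T)) :=
  Measure.pi.instIsProbabilityMeasure (fun _ : Fin m => (volume : Measure (Fin p → T)))
instance instHaarOm (m p : ℕ) : (volume : Measure (Om m p)).IsAddHaarMeasure :=
  Measure.prod.instIsAddHaarMeasure (volume : Measure (Fin (m+p) → Fin p → T)) volume
instance instHaarEE (m p : ℕ) : (volume : Measure (EE m p)).IsAddHaarMeasure :=
  Measure.prod.instIsAddHaarMeasure (volume : Measure (Fin (m+p) → Fin p → ℝ)) volume
instance instHaarT2 (p : ℕ) : (volume : Measure ((Fin p → T) × (Fin p → T))).IsAddHaarMeasure :=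
  Measure.prod.instIsAddHaarMeasure (volume : Measure (Fin p → T)) volume
instance instProbOm (m p : ℕ) : IsProbabilityMeasure (volume : Measure (Om m p)) := 
  Measure.prod.instIsProbabilityMeasure _ _
instance instProbT2 (p : ℕ) : IsProbabilityMeasure (volume : Measure ((Fin p → T) × (Fin p → T))) := 
  Measure.prod.instIsProbabilityMeasure _ _

instance instSCTT (m p : ℕ) : SecondCountableTopology (Fin m → Fin p → T) :=
  inferInstance
instance instBorelTT (m p : ℕ) : BorelSpace (Fin m → Fin p → T) :=
  Pi.borelSpace
instance instBorelOm (m p : ℕ) : BorelSpace (Om m p) := Prod.borelSpace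
instance instBorelEE (m p : ℕ) : BorelSpace (EE m p) := Prod.borelSpace

def phi {m p : ℕ} (i : Fin (m+p)) (a : Fin m → ℤ) : Om m p →+ (Fin p → T) where
  toFun z := fun l => ∑ j, a j • z.1 (Fin.castAdd p j) l - z.2 i l
  map_zero' := by ext l; simp
  map_add' z w := by
    ext l; simp [Finset.sum_add_distrib]; abel

lemma phi_cont {m p : ℕ} (i : Fin (m+p)) (a : Fin m → ℤ) : Continuous (phi i a) := by
  change Continuous (fun z : Om m p => fun l => ∑ j, a j • z.1 (Fin.castAdd p j) l - z.2 i l)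
  fun_prop

lemma phi_surj {m p : ℕ} (i : Fin (m+p)) (a : Fin m → ℤ) : Function.Surjective (phi i a) := by
  intro s
  refine ⟨(0, fun _ => -s), ?_⟩
  ext l; simp [phi]

lemma T_div (d : ℤ) (hd : d ≠ 0) (s : T) : ∃ t : T, d • t = s := by
  induction s using QuotientAddGroup.induction_on with
  | H r =>
    refine ⟨((r / d : ℝ) : T), ?_⟩
    have : (d : ℝ) ≠ 0 := by exact_mod_cast hd
    change d • ((r / d : ℝ) : T) = ((r : ℝ) : T)
    rw [← AddCircle.coe_zsmul]
    congr 1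
    simp; field_simp

lemma phi_pair_surj {m p : ℕ} (i : Fin (m+p)) (a a' : Fin m → ℤ) (h : a ≠ a') :
    Function.Surjective ((phi i a).prod (phi i a')) := by
  rintro ⟨s, t⟩
  obtain ⟨j, hj⟩ := Function.ne_iff.1 h
  choose u hu using fun l => T_div (a j - a' j) (sub_ne_zero.2 hj) (s l - t l)
  let A : Fin (m+p) → Fin p → T := fun j' => if j' = Fin.castAdd p j then u else 0
  have hA : ∀ (b : Fin m → ℤ) l, ∑ j', b j' • A (Fin.castAdd p j') l = b j • u l := by
    intro b l
    rw [Finset.sum_eq_single j]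
    · simp [A]
    · intro k _ hk
      simp [A, hk]
    · simp
  refine ⟨(A, fun _ l => a j • u l - s l), ?_⟩
  ext l
  · simp [phi, hA]
  · have := hu l
    simp only [AddMonoidHom.prod_apply, phi, AddMonoidHom.coe_mk, ZeroHom.coe_mk, hA]
    rw [sub_zsmul] at this
    have h2 : a j • u l = s l - t l + a' j • u l := by rw [← this]; abel
    rw [h2]; abel

lemma phi_mp {m p : ℕ} (i : Fin (m+p)) (a : Fin m → ℤ) :
    MeasurePreserving (phi i a) volume volume :=
  AddMonoidHom.measurePreserving (phi_cont i a) (phi_surj i a) (by simp)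

open ProbabilityTheory in
lemma phi_indep {m p : ℕ} (i : Fin (m+p)) (a a' : Fin m → ℤ) (h : a ≠ a') :
    IndepFun (phi i a) (phi i a') (volume : Measure (Om m p)) := by
  rw [indepFun_iff_map_prod_eq_prod_map_map (phi_cont i a).measurable.aemeasurable
    (phi_cont i a').measurable.aemeasurable, (phi_mp i a).map_eq, (phi_mp i a').map_eq]
  have : MeasurePreserving ((phi i a).prod (phi i a')) (volume : Measure (Om m p)) volume :=
    AddMonoidHom.measurePreserving ((phi_cont i a).prodMk (phi_cont i a')) 
      (phi_pair_surj i a a' h) (by simp)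
  exact this.map_eq

open ProbabilityTheory in
/-- second moment bound -/
lemma second_moment {m p : ℕ} (i : Fin (m+p)) (S : Finset (Fin m → ℤ)) (B : Set (Fin p → T))
    (hB : MeasurableSet B) (q : ℝ) (hq : 0 < q) (hBq : (volume : Measure (Fin p → T)).real B = q)
    (hS : S.Nonempty) :
    (volume : Measure (Om m p)) {z | ∀ a ∈ S, phi i a z ∉ B} ≤ ENNReal.ofReal (1 / (S.card * q)) := by
  classical
  let f : (Fin p → T) → ℝ := B.indicator 1
  have hf : Measurable f := measurable_one.indicator hB
  let X : (Fin m → ℤ) → Om m p → ℝ := fun a z => f (phi i a z)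
  have hXm : ∀ a, Measurable (X a) := fun a => hf.comp (phi_cont i a).measurable
  have hX01 : ∀ a z, X a z = 0 ∨ X a z = 1 := by
    intro a z
    by_cases hz : phi i a z ∈ B <;> simp [X, f, hz]
  have hL : ∀ a, MemLp (X a) 2 (volume : Measure (Om m p)) := by
    intro a
    refine MemLp.of_bound (hXm a).aestronglyMeasurable 1 (Filter.Eventually.of_forall fun z => ?_)
    rcases hX01 a z with h | h <;> simp [h]
  have hint : ∀ a, ∫ z, X a z = q := by
    intro a
    have h1 := integral_map (μ := (volume : Measure (Om m p)))
      (phi_cont i a).measurable.aemeasurable (f := f) hf.aestronglyMeasurable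
    rw [(phi_mp i a).map_eq] at h1
    rw [← h1, ← hBq]
    exact integral_indicator_one hB
  have hvar : ∀ a, variance (X a) volume ≤ q := by
    intro a
    refine (variance_le_expectation_sq (hXm a).aestronglyMeasurable).trans ?_
    rw [← hint a]
    apply le_of_eq
    congr 1
    ext z
    rcases hX01 a z with h | h <;> simp [h]
  have hsum : variance (∑ a ∈ S, X a) volume ≤ S.card * q := by
    rw [IndepFun.variance_sum (fun a _ => hL a)]
    · calc _ ≤ ∑ a ∈ S, q := Finset.sum_le_sum fun a _ => hvar a
        _ = _ := by simp
    · intro a _ a' _ h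
      exact (phi_indep i a a' h).comp hf hf
  have hc : (0 : ℝ) < S.card * q := by
    have := hS.card_pos
    positivity
  have hI : ∫ z, (∑ a ∈ S, X a) z = S.card * q := by
    simp only [Finset.sum_apply]
    rw [integral_finsetSum _ fun a _ => (hL a).integrable (by norm_num)]
    simp [hint]
  have hch := meas_ge_le_variance_div_sq (memLp_finsetSum' S fun a _ => hL a) hc
  rw [hI] at hch
  refine (measure_mono ?_).trans (hch.trans (ENNReal.ofReal_le_ofReal ?_))
  · intro z hz
    have : (∑ a ∈ S, X a) z = 0 := by
      rw [Finset.sum_apply]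
      refine Finset.sum_eq_zero fun a ha => ?_
      simp [X, f, hz a ha]
    simp only [Set.mem_ofPred_eq, this]
    rw [zero_sub, abs_neg, abs_of_pos hc]
  · rw [div_le_div_iff₀ (by positivity) hc]
    nlinarith

lemma torus_bc {m p : ℕ} (i : Fin (m+p)) (c : Fin m → ℤ) (μ : ℝ) (hμ : 0 ≤ μ)
    (hμ' : p * μ < m) :
    ∀ᵐ z : Om m p, ∀ᶠ k : ℕ in Filter.atTop, ∃ a : Fin m → ℤ,
      (∀ j, 2 ^ k * c j ≤ a j ∧ a j < 2 ^ k * (c j + 1)) ∧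
      ∀ l, ‖phi i a z l‖ < (2 : ℝ) ^ (-(k * μ)) := by
  classical
  let r : ℕ → ℝ := fun k => (2 : ℝ) ^ (-(k * μ))
  have hr0 : ∀ k, 0 < r k := fun k => by positivity
  have hr1 : ∀ k, r k ≤ 1 := fun k =>
    Real.rpow_le_one_of_one_le_of_nonpos (by norm_num) (by have : 0 ≤ k * μ := by positivity
                                                           linarith)
  let S : ℕ → Finset (Fin m → ℤ) := fun k =>
    Fintype.piFinset fun j => Finset.Ico (2 ^ k * c j) (2 ^ k * (c j + 1))
  have hScard : ∀ k, ((S k).card : ℝ) = ((2:ℝ) ^ k) ^ m := by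
    intro k
    have h : ∀ j, (2 ^ k * (c j + 1) - 2 ^ k * c j).toNat = 2 ^ k := by
      intro j
      have : (2 ^ k * (c j + 1) - 2 ^ k * c j : ℤ) = ((2 ^ k : ℕ) : ℤ) := by push_cast; ring
      rw [this, Int.toNat_natCast]
    simp [S, Fintype.card_piFinset, Int.card_Ico, h]
  have hSne : ∀ k, (S k).Nonempty := by
    intro k
    rw [← Finset.card_pos]
    have : (0:ℝ) < (S k).card := by rw [hScard]; positivity
    exact_mod_cast this
  let B : ℕ → Set (Fin p → T) := fun k => Metric.closedBall 0 (r k / 2)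
  have hB : ∀ k, (volume : Measure (Fin p → T)).real (B k) = r k ^ p := by
    intro k
    have h1 : (volume : Measure (Fin p → T)) (B k) = ENNReal.ofReal (r k ^ p) := by
      change Measure.pi _ _ = _
      rw [Measure.pi_closedBall _ _ (by have := hr0 k; positivity)]
      have : ∀ l : Fin p, volume (Metric.closedBall ((0 : Fin p → T) l) (r k / 2)) = ENNReal.ofReal (r k) := by
        intro l
        rw [AddCircle.volume_closedBall]
        congr 1
        rw [min_eq_right] <;> linarith [hr1 k]
      simp only [this, Finset.prod_const, Finset.card_univ, Fintype.card_fin]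
      rw [ENNReal.ofReal_pow (hr0 k).le]
    rw [Measure.real, h1, ENNReal.toReal_ofReal (by have := hr0 k; positivity)]
  have hbd : ∀ k, (volume : Measure (Om m p)) {z | ∀ a ∈ S k, phi i a z ∉ B k} ≤
      ENNReal.ofReal (((2:ℝ) ^ (-(m - p * μ))) ^ k) := by
    intro k
    refine (second_moment i (S k) (B k) measurableSet_closedBall (r k ^ p)
      (pow_pos (hr0 k) _) (hB k) (hSne k)).trans (le_of_eq ?_)
    congr 1
    rw [hScard]
    simp only [r]
    rw [← Real.rpow_natCast, ← Real.rpow_natCast, ← Real.rpow_natCast, ← Real.rpow_natCast,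
      ← Real.rpow_mul (by norm_num), ← Real.rpow_mul (by norm_num), ← Real.rpow_mul (by norm_num),
      ← Real.rpow_add (by norm_num), one_div, ← Real.rpow_neg (by norm_num)]
    congr 1
    ring
  have hs : Summable fun k : ℕ => ((2:ℝ) ^ (-(m - p * μ))) ^ k := by
    apply summable_geometric_of_lt_one (by positivity)
    exact Real.rpow_lt_one_of_one_lt_of_neg (by norm_num) (by linarith)
  have hfin : ∑' k, (volume : Measure (Om m p)) {z | ∀ a ∈ S k, phi i a z ∉ B k} ≠ ⊤ :=
    ne_top_of_le_ne_top hs.tsum_ofReal_ne_top (ENNReal.tsum_le_tsum hbd)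
  filter_upwards [ae_eventually_notMem hfin] with z hz
  filter_upwards [hz] with k hk
  simp only [not_forall, not_not] at hk
  obtain ⟨a, ha, hak⟩ := hk
  refine ⟨a, fun j => by simpa using (Fintype.mem_piFinset.1 ha) j, fun l => ?_⟩
  have h1 : ‖phi i a z‖ ≤ r k / 2 := by simpa [B] using hak
  have := norm_le_pi_norm (phi i a z) l
  have := hr0 k
  change _ < r k
  linarith

def QQ (m p : ℕ) : EE m p → Om m p := fun z => (fun i l => (z.1 i l : T), fun i l => (z.2 i l : T))

lemma mp1 {p : ℕ} (v : Fin p → ℝ) : MeasurePreserving (fun (x : Fin p → ℝ) l => (x l : T))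
    (volume.restrict (Set.pi Set.univ fun l => Set.Ioc (v l) (v l + 1))) volume := by
  change MeasurePreserving _ (Measure.restrict (Measure.pi _) _) _
  rw [Measure.restrict_pi_pi]
  exact measurePreserving_pi _ _ (fun l => AddCircle.measurePreserving_mk 1 (v l))

lemma mp2 {m p : ℕ} (v : Fin m → Fin p → ℝ) :
    MeasurePreserving (fun (x : Fin m → Fin p → ℝ) i l => (x i l : T))
    (volume.restrict (Set.pi Set.univ fun i => Set.pi Set.univ fun l =>
      Set.Ioc (v i l) (v i l + 1))) volume := by
  change MeasurePreserving _ (Measure.restrict (Measure.pi _) _) _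
  rw [Measure.restrict_pi_pi]
  exact measurePreserving_pi _ _ (fun i => mp1 (v i))

lemma QQ_ae {m p : ℕ} {P : Om m p → Prop} (h : ∀ᵐ z, P z) : ∀ᵐ z : EE m p, P (QQ m p z) := by
  let C : (Fin (m+p) → Fin p → ℤ) → Set (Fin (m+p) → Fin p → ℝ) := fun v =>
    Set.pi Set.univ fun i => Set.pi Set.univ fun l => Set.Ioc (v i l : ℝ) (v i l + 1)
  have hcov : (⋃ v : (Fin (m+p) → Fin p → ℤ) × (Fin (m+p) → Fin p → ℤ), C v.1 ×ˢ C v.2) = Set.univ := by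
    refine Set.eq_univ_of_forall fun z => Set.mem_iUnion.2
      ⟨(fun i l => ⌈z.1 i l⌉ - 1, fun i l => ⌈z.2 i l⌉ - 1), ?_⟩
    simp only [C, Set.mem_prod, Set.mem_pi, Set.mem_Ioc]
    refine ⟨fun i _ l _ => ?_, fun i _ l _ => ?_⟩ <;> push_cast
    · exact ⟨by linarith [Int.ceil_lt_add_one (z.1 i l)], by linarith [Int.le_ceil (z.1 i l)]⟩
    · exact ⟨by linarith [Int.ceil_lt_add_one (z.2 i l)], by linarith [Int.le_ceil (z.2 i l)]⟩
  rw [← Measure.restrict_univ (μ := (volume : Measure (EE m p))), ← hcov, ae_restrict_iUnion_iff]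
  intro v
  have : MeasurePreserving (QQ m p) ((volume : Measure (EE m p)).restrict (C v.1 ×ˢ C v.2)) volume := by
    change MeasurePreserving _ (Measure.restrict (Measure.prod _ _) _) _
    rw [← Measure.prod_restrict]
    exact (mp2 (fun i l => (v.1 i l : ℝ))).prod (mp2 (fun i l => (v.2 i l : ℝ)))
  exact this.quasiMeasurePreserving.ae h

lemma real_bc {m p : ℕ} (μ : ℝ) (hμ : 0 ≤ μ) (hμ' : p * μ < m) :
    ∀ᵐ z : EE m p, ∀ (i : Fin (m+p)) (c : Fin m → ℤ), ∀ᶠ k : ℕ in Filter.atTop,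
      ∃ (a : Fin m → ℤ) (b : Fin p → ℤ),
      (∀ j, 2 ^ k * c j ≤ a j ∧ a j < 2 ^ k * (c j + 1)) ∧
      ∀ l, |∑ j, a j * z.1 (Fin.castAdd p j) l + b l - z.2 i l| < (2 : ℝ) ^ (-(k * μ)) := by
  rw [ae_all_iff]; intro i
  rw [ae_all_iff]; intro c
  filter_upwards [QQ_ae (torus_bc i c μ hμ hμ')] with z hz
  filter_upwards [hz] with k hk
  obtain ⟨a, ha, hak⟩ := hk
  refine ⟨a, fun l => - round (∑ j, a j * z.1 (Fin.castAdd p j) l - z.2 i l), ha, fun l => ?_⟩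
  have h1 := hak l
  have h2 : phi i a (QQ m p z) l =
      ((∑ j, a j * z.1 (Fin.castAdd p j) l - z.2 i l : ℝ) : T) := by
    simp only [phi, QQ, AddMonoidHom.coe_mk, ZeroHom.coe_mk, AddCircle.coe_sub]
    congr 1
    have := map_sum (QuotientAddGroup.mk' (AddSubgroup.zmultiples (1:ℝ))) (fun j => (a j : ℝ) * z.1 (Fin.castAdd p j) l) Finset.univ
    refine Eq.trans ?_ this.symm
    refine Finset.sum_congr rfl fun j _ => ?_
    rw [← zsmul_eq_mul]
    rfl
  rw [h2, UnitAddCircle.norm_eq] at h1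
  convert! h1 using 2
  push_cast
  ring

def bot {m p : ℕ} (x : Fin (m+p) → Fin p → ℝ) : Matrix (Fin p) (Fin p) ℝ :=
  Matrix.of fun q l => x (Fin.natAdd m q) l

lemma bot_ae (m p : ℕ) : ∀ᵐ x : Fin (m+p) → Fin p → ℝ, (bot x).det ≠ 0 := by
  let v : Fin (m+p) → Fin p → ℝ := fun i l => if i = Fin.natAdd m l then 1 else 0
  have hv : bot v = 1 := by
    ext q l
    simp [bot, v, Matrix.one_apply]
  have hbc : Continuous (fun x : Fin (m+p) → Fin p → ℝ => (bot x).det) := by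
    apply Continuous.matrix_det
    apply continuous_matrix
    intro i j
    simp only [bot, Matrix.of_apply]
    fun_prop
  refine ae_mem_of_ae_add_linearMap_mem (𝕜 := ℝ) (LinearMap.toSpanSingleton ℝ _ v) volume volume
    (s := {x | (bot x).det ≠ 0}) ?_ ?_
  · exact (isOpen_ne_fun hbc continuous_const).measurableSet
  · intro y
    have hfin : Set.Finite {t : ℝ | (bot (y + t • v)).det = 0} := by
      have hne : ((-bot y).charpoly) ≠ 0 := (Matrix.charpoly_monic _).ne_zero
      refine (Polynomial.finite_setOfPred_isRoot hne).subset ?_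
      intro t ht
      change Polynomial.eval t _ = 0
      rw [Matrix.eval_charpoly]
      have : bot (y + t • v) = Matrix.scalar (Fin p) t - -bot y := by
        rw [sub_neg_eq_add, add_comm (Matrix.scalar (Fin p) t)]
        have : bot (y + t • v) = bot y + t • bot v := by ext; simp [bot]
        rw [this, hv]
        ext i j
        simp [Matrix.one_apply, Matrix.diagonal_apply]
      rw [← this]; exact ht
    have := hfin.measure_zero volume
    exact measure_eq_zero_iff_ae_notMem.1 this

def Phi (m p : ℕ) (z : EE m p) : EE m p :=
  (Fin.append (fun (j : Fin m) l => ∑ q, z.1 (Fin.castAdd p j) q * z.1 (Fin.natAdd m q) l)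
    (fun q => z.1 (Fin.natAdd m q)),
   fun i l => ∑ q, z.2 i q * z.1 (Fin.natAdd m q) l)

lemma Phi_diff (m p : ℕ) : Differentiable ℝ (Phi m p) := by
  refine Differentiable.prodMk ?_ ?_
  · refine differentiable_pi.2 fun i => ?_
    refine Fin.addCases (fun j => ?_) (fun q => ?_) i
    · simp only [Fin.append_left]; fun_prop
    · simp only [Fin.append_right]; fun_prop
  · fun_prop

lemma Phi_ae {m p : ℕ} {P : EE m p → Prop} (h : ∀ᵐ z, P z) :
    ∀ᵐ z : EE m p, (bot z.1).det ≠ 0 → ∃ w, P w ∧ Phi m p w = z := by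
  have h0 : volume {z | ¬ P z} = 0 := h
  have h1 := addHaar_image_eq_zero_of_differentiableOn_of_addHaar_eq_zero volume
    (Phi_diff m p).differentiableOn h0
  filter_upwards [measure_eq_zero_iff_ae_notMem.1 h1] with z hz hdet
  let X := bot z.1
  have hX : IsUnit X.det := isUnit_iff_ne_zero.2 hdet
  let w : EE m p := (Fin.append (fun (j : Fin m) l => ∑ q, z.1 (Fin.castAdd p j) q * X⁻¹ q l)
    (fun q => z.1 (Fin.natAdd m q)), fun i l => ∑ q, z.2 i q * X⁻¹ q l)
  have key : ∀ (u : Fin p → ℝ) l, ∑ q, (∑ s, u s * X⁻¹ s q) * z.1 (Fin.natAdd m q) l = u l := by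
    intro u l
    have : (u ᵥ* X⁻¹) ᵥ* X = u := by
      rw [Matrix.vecMul_vecMul, Matrix.nonsing_inv_mul _ hX, Matrix.vecMul_one]
    exact congrFun this l
  have hw : Phi m p w = z := by
    refine Prod.ext ?_ ?_
    · ext i l
      refine Fin.addCases (fun j => ?_) (fun q => ?_) i
      · simp only [Phi, w, Fin.append_left, Fin.append_right]
        exact key _ l
      · simp only [Phi, w, Fin.append_right]
    · ext i l
      simp only [Phi, w, Fin.append_right]
      exact key _ l
  refine ⟨w, ?_, hw⟩
  by_contra hP
  exact hz ⟨w, hP, hw⟩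

def MM {m p : ℕ} (Z : (Fin (m+p) → Fin m → ℝ) × (Fin (m+p) → Fin p → ℝ)) :
    Matrix (Fin m ⊕ Fin p) (Fin m ⊕ Fin p) ℝ :=
  Matrix.of fun r => Sum.elim (Z.1 (finSumFinEquiv r)) (Z.2 (finSumFinEquiv r))

lemma MM_cont {m p : ℕ} : Continuous (fun Z => (MM (m := m) (p := p) Z).det) := by
  apply Continuous.matrix_det
  apply continuous_matrix
  intro r s
  cases s <;> simp only [MM, Matrix.of_apply, Sum.elim_inl, Sum.elim_inr] <;> fun_prop

/-- The target integer directions. -/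
def uu {m p : ℕ} (D : Fin m → ℤ) (i : Fin (m+p)) (j : Fin m) : ℤ :=
  if i = Fin.castAdd p j then D j else 0

lemma MM_uu {m p : ℕ} (D : Fin m → ℤ) (y : Fin (m+p) → Fin p → ℝ) :
    (MM (fun i j => (uu D i j : ℝ), y)).det = (∏ j, (D j : ℝ)) * (bot y).det := by
  have : MM (fun i j => (uu D i j : ℝ), y) =
      Matrix.fromBlocks (Matrix.diagonal fun j => (D j : ℝ))
        (Matrix.of fun j l => y (Fin.castAdd p j) l) 0 (bot y) := by
    ext r s
    rcases r with r | r <;> rcases s with s | s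
    · by_cases h : r = s <;> simp [MM, uu, h]
    · simp [MM]
    · have : Fin.natAdd m r ≠ Fin.castAdd p s := by
        intro h
        have := congrArg Fin.val h
        simp at this; omega
      simp [MM, uu, this]
    · simp [MM, bot]
  rw [this, Matrix.det_fromBlocks_zero₂₁, Matrix.det_diagonal]

lemma det_pos_of {m p : ℕ} (γ : Matrix (Fin (m+p)) (Fin (m+p)) ℤ) (x : Fin (m+p) → Fin p → ℝ)
    (τ : ℝ) (hτ : 0 < τ)
    (h : 0 < (MM (fun i j => (γ i (Fin.castAdd p j) : ℝ) * τ,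
      fun i l => ∑ s, (γ i s : ℝ) * x s l)).det * (bot x).det) : 0 < γ.det := by
  have hM : MM (fun i j => (γ i (Fin.castAdd p j) : ℝ) * τ,
      fun i l => ∑ s, (γ i s : ℝ) * x s l) =
      ((γ.map (Int.cast : ℤ → ℝ)).submatrix finSumFinEquiv finSumFinEquiv) *
      Matrix.fromBlocks (Matrix.diagonal fun _ : Fin m => τ)
        (Matrix.of fun j l => x (Fin.castAdd p j) l) 0 (bot x) := by
    ext r s
    rw [Matrix.mul_apply, Fintype.sum_sum_type]
    rcases s with s | s
    · simp [MM, Matrix.diagonal_apply]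
    · simp [MM, bot, Fin.sum_univ_add]
  rw [hM, Matrix.det_mul, Matrix.det_submatrix_equiv_self, Matrix.det_fromBlocks_zero₂₁,
    Matrix.det_diagonal] at h
  have h2 : (γ.map (Int.cast : ℤ → ℝ)).det = (γ.det : ℝ) := 
    (Int.cast_det γ).symm
  rw [h2] at h
  have h3 : (γ.det : ℝ) * ((∏ _j : Fin m, τ) * ((bot x).det * (bot x).det)) > 0 := by linarith
  have h4 : 0 ≤ (∏ _j : Fin m, τ) * ((bot x).det * (bot x).det) :=
    mul_nonneg (Finset.prod_nonneg fun _ _ => hτ.le) (mul_self_nonneg _)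
  have := pos_of_mul_pos_left h3 h4
  exact_mod_cast this

lemma approx {m p : ℕ} (hm : 0 < m) (μ μ' : ℝ) (hμ : 0 ≤ μ) (hμμ : μ < μ') (w : EE m p)
    (hw : ∀ (i : Fin (m+p)) (c : Fin m → ℤ), ∀ᶠ k : ℕ in Filter.atTop,
      ∃ (a : Fin m → ℤ) (b : Fin p → ℤ),
      (∀ j, 2 ^ k * c j ≤ a j ∧ a j < 2 ^ k * (c j + 1)) ∧
      ∀ l, |∑ j, a j * w.1 (Fin.castAdd p j) l + b l - w.2 i l| < (2 : ℝ) ^ (-(k * μ')))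
    (x y : Matrix (Fin (m+p)) (Fin p) ℝ) (hxy : Phi m p w = (x, y))
    (hx : (bot x).det ≠ 0) (hy : (bot y).det ≠ 0) :
    {γ : Matrix (Fin (m+p)) (Fin (m+p)) ℤ | 0 < γ.det ∧
    ‖(γ.map (Int.cast : ℤ → ℝ)) * x - y‖ < ‖γ.map (Int.cast : ℤ → ℝ)‖ ^ (-μ)}.Infinite := by
  classical
  obtain ⟨sg, hsg1, hsg⟩ : ∃ s : ℤ, (s = 1 ∨ s = -1) ∧ 0 < s * ((bot y).det * (bot x).det) := by
    rcases lt_or_gt_of_ne (mul_ne_zero hy hx) with h | h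
    · exact ⟨-1, Or.inr rfl, by push_cast; linarith⟩
    · exact ⟨1, Or.inl rfl, by push_cast; linarith⟩
  let j0 : Fin m := ⟨0, hm⟩
  let D : Fin m → ℤ := fun j => if j = j0 then sg else 1
  have hD : ∏ j, (D j : ℝ) = sg := by
    rw [Finset.prod_eq_single j0]
    · simp [D]
    · intro j _ hj; simp [D, hj]
    · simp
  have hD1 : ∀ j, D j = 1 ∨ D j = -1 := by
    intro j
    by_cases h : j = j0 <;> simp [D, h, hsg1]
  have hu1 : ∀ i j, -1 ≤ uu (p := p) D i j ∧ uu (p := p) D i j ≤ 1 := by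
    intro i j
    unfold uu
    split_ifs
    · rcases hD1 j with h | h <;> rw [h] <;> norm_num
    · norm_num
  let Z0 : (Fin (m+p) → Fin m → ℝ) × (Fin (m+p) → Fin p → ℝ) := (fun i j => (uu D i j : ℝ), y)
  have hpos : 0 < (MM Z0).det * (bot x).det := by
    have h := MM_uu D y
    rw [hD] at h
    have h' : (MM Z0).det = sg * (bot y).det := h
    rw [h', mul_assoc]; exact hsg
  have hopen : IsOpen {Z : (Fin (m+p) → Fin m → ℝ) × (Fin (m+p) → Fin p → ℝ) | 
      0 < (MM Z).det * (bot x).det} :=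
    isOpen_lt continuous_const (MM_cont.mul continuous_const)
  obtain ⟨δ, hδ, hball⟩ := Metric.isOpen_iff.1 hopen Z0 hpos
  obtain ⟨t, ht⟩ := exists_nat_gt (max 2 (1 / δ))
  have ht2 : (2:ℝ) < t := (le_max_left _ _).trans_lt ht
  have htδ : 1 / (t:ℝ) < δ := by
    rw [div_lt_comm₀ (by linarith) hδ]; exact (le_max_right _ _).trans_lt ht
  let K : ℝ := ‖w‖ + 1
  have hK1 : 1 ≤ K := by simp [K]
  have hwK1 : ∀ i l, |w.1 i l| ≤ K := fun i l => by
    have h1 := norm_le_pi_norm (w.1 i) l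
    have h2 := norm_le_pi_norm w.1 i
    have h3 := norm_fst_le w
    rw [Real.norm_eq_abs] at h1
    simp only [K]; linarith
  have hwK2 : ∀ i l, |w.2 i l| ≤ K := fun i l => by
    have h1 := norm_le_pi_norm (w.2 i) l
    have h2 := norm_le_pi_norm w.2 i
    have h3 := norm_snd_le w
    rw [Real.norm_eq_abs] at h1
    simp only [K]; linarith
  have hμ'0 : 0 < μ' := by linarith
  let C : ℝ := 1 + K + (m + 1) * (t + 1) * K
  have hC : 0 < C := by positivity
  -- eventual inequalities
  have hpow : ∀ (s : ℝ), 0 < s → Filter.Tendsto (fun k : ℕ => (2:ℝ) ^ ((k:ℝ) * s)) Filter.atTop Filter.atTop := by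
    intro s hs
    have h1 : (fun k : ℕ => (2:ℝ) ^ ((k:ℝ) * s)) = fun k : ℕ => ((2:ℝ) ^ s) ^ k := by
      ext k
      rw [← Real.rpow_natCast, ← Real.rpow_mul (by norm_num), mul_comm]
    rw [h1]
    exact tendsto_pow_atTop_atTop_of_one_lt (Real.one_lt_rpow (by norm_num) hs)
  have ev1 : ∀ᶠ k : ℕ in Filter.atTop, p * K * (2:ℝ) ^ (-(k * μ')) < δ := by
    filter_upwards [(hpow μ' hμ'0).eventually_gt_atTop (p * K / δ)] with k hk
    rw [Real.rpow_neg (by norm_num), ← div_eq_mul_inv, div_lt_comm₀ (by positivity) hδ]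
    exact hk
  have ev2 : ∀ᶠ k : ℕ in Filter.atTop, p * K * (2:ℝ) ^ (-(k * μ')) < (C * 2 ^ k) ^ (-μ) := by
    filter_upwards [(hpow (μ' - μ) (by linarith)).eventually_gt_atTop (p * K * C ^ μ)] with k hk
    rw [Real.mul_rpow hC.le (by positivity), ← Real.rpow_natCast, ← Real.rpow_mul (by norm_num)]
    have h1 : (2:ℝ) ^ ((k:ℝ) * -μ) = (2:ℝ) ^ ((k:ℝ) * (μ' - μ)) * (2:ℝ) ^ (-(k * μ')) := by
      rw [← Real.rpow_add (by norm_num)]; congr 1; ring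
    rw [h1, Real.rpow_neg hC.le, ← mul_assoc]
    refine mul_lt_mul_of_pos_right ?_ (by positivity)
    rw [← div_eq_inv_mul, lt_div_iff₀ (by positivity)]
    exact hk
  have ev3 := Filter.eventually_all.2 fun i => hw i (fun j => t * uu D i j)
  obtain ⟨k0, hk0⟩ := Filter.eventually_atTop.1 (ev1.and (ev2.and ev3))
  -- the construction
  have main : ∀ k ≥ k0, ∃ γ : Matrix (Fin (m+p)) (Fin (m+p)) ℤ, (0 < γ.det ∧
    ‖(γ.map (Int.cast : ℤ → ℝ)) * x - y‖ < ‖γ.map (Int.cast : ℤ → ℝ)‖ ^ (-μ)) ∧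
      (2:ℝ) ^ k ≤ ‖γ.map (Int.cast : ℤ → ℝ)‖ := by
    intro k hk
    obtain ⟨h1, h2, h3⟩ := hk0 k hk
    choose a b hab herr using h3
    have h2k : (1:ℝ) ≤ 2 ^ k := one_le_pow₀ (by norm_num)
    have habR : ∀ i j, (2:ℝ) ^ k * (t * uu D i j) ≤ a i j ∧ (a i j : ℝ) < 2 ^ k * (t * uu D i j + 1) := by
      intro i j
      have := hab i j
      exact ⟨by exact_mod_cast this.1, by exact_mod_cast this.2⟩
    have haK : ∀ i j, |(a i j : ℝ)| ≤ 2 ^ k * (t + 1) := by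
      intro i j
      obtain ⟨g1, g2⟩ := habR i j
      obtain ⟨g3, g4⟩ := hu1 i j
      have g3' : (-1:ℝ) ≤ uu (p := p) D i j := by exact_mod_cast g3
      have g4' : (uu (p := p) D i j : ℝ) ≤ 1 := by exact_mod_cast g4
      rw [abs_le]
      constructor
      · refine le_trans ?_ g1
        rw [← mul_neg]
        gcongr
        nlinarith
      · refine g2.le.trans ?_
        gcongr
        nlinarith
    have hr1 : (2:ℝ) ^ (-(k * μ')) ≤ 1 :=
      Real.rpow_le_one_of_one_le_of_nonpos (by norm_num) (by 
        have : 0 ≤ k * μ' := by positivity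
        linarith)
    have hbK : ∀ i l, |(b i l : ℝ)| ≤ C * 2 ^ k := by
      intro i l
      have e1 := herr i l
      have e2 : |∑ j, a i j * w.1 (Fin.castAdd p j) l| ≤ m * (2 ^ k * (t + 1) * K) := by
        refine (Finset.abs_sum_le_sum_abs _ _).trans ?_
        calc _ ≤ ∑ j : Fin m, (2:ℝ) ^ k * (t + 1) * K := Finset.sum_le_sum fun j _ => by
              rw [abs_mul]
              exact mul_le_mul (haK i j) (hwK1 _ _) (abs_nonneg _) (by positivity)
          _ = _ := by simp
      have e3 := hwK2 i l
      rw [abs_lt] at e1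
      rw [abs_le] at e2 e3 ⊢
      have e4 : 1 + K ≤ (1 + K) * 2 ^ k := le_mul_of_one_le_right (by positivity) h2k
      have e5 : 0 ≤ (t + 1) * K * 2 ^ k := by positivity
      have e6 : C * 2 ^ k = (1 + K) * 2 ^ k + m * (2 ^ k * (t + 1) * K) + (t + 1) * K * 2 ^ k := by
        simp only [C]; ring
      rw [e6]
      constructor <;> linarith
    have haC : ∀ i j, |(a i j : ℝ)| ≤ C * 2 ^ k := by
      intro i j
      refine (haK i j).trans ?_
      have e6 : C * 2 ^ k = (1 + K) * 2 ^ k + m * (2 ^ k * (t + 1) * K) + (t + 1) * 2 ^ k * K := by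
        simp only [C]; ring
      have e7 : (t + 1) * 2 ^ k ≤ ((t:ℝ) + 1) * 2 ^ k * K := le_mul_of_one_le_right (by positivity) hK1
      rw [e6]
      have : 0 ≤ (1 + K) * 2 ^ k := by positivity
      have : 0 ≤ m * (2 ^ k * (t + 1) * K) := by positivity
      linarith
    let γ : Matrix (Fin (m+p)) (Fin (m+p)) ℤ := Matrix.of fun i => Fin.append (a i) (b i)
    have hγl : ∀ i j, γ i (Fin.castAdd p j) = a i j := fun i j => by simp [γ]
    have hγr : ∀ i j, γ i (Fin.natAdd m j) = b i j := fun i j => by simp [γ]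
    have hγC : ‖γ.map (Int.cast : ℤ → ℝ)‖ ≤ C * 2 ^ k := by
      rw [Matrix.norm_le_iff (by positivity)]
      intro i s
      rw [Matrix.map_apply, Real.norm_eq_abs]
      refine Fin.addCases (fun j => ?_) (fun l => ?_) s
      · rw [hγl]; exact haC i j
      · rw [hγr]; exact hbK i l
    have hγ2 : (2:ℝ) ^ k ≤ ‖γ.map (Int.cast : ℤ → ℝ)‖ := by
      refine le_trans ?_ (Matrix.norm_entry_le_entrywise_sup_norm _ (i := Fin.castAdd p j0) (j := Fin.castAdd p j0))
      rw [Matrix.map_apply, Real.norm_eq_abs, hγl]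
      obtain ⟨g1, g2⟩ := habR (Fin.castAdd p j0) j0
      have hu : uu (p := p) D (Fin.castAdd p j0) j0 = sg := by simp [uu, D]
      rw [hu] at g1 g2
      rcases hsg1 with h | h
      · rw [h] at g1
        push_cast at g1
        refine le_trans ?_ (le_abs_self _)
        nlinarith
      · rw [h] at g2
        push_cast at g2
        refine le_trans ?_ (neg_le_abs _)
        nlinarith
    have hx1 : ∀ i l, x i l = (Phi m p w).1 i l := fun i l => by rw [hxy]
    have hy1 : ∀ i l, y i l = (Phi m p w).2 i l := fun i l => by rw [hxy]
    have hent : ∀ i l, |∑ s, (γ i s : ℝ) * x s l - y i l| ≤ p * K * (2:ℝ) ^ (-(k * μ')) := by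
      intro i l
      have e1 : ∑ s, (γ i s : ℝ) * x s l - y i l =
          ∑ q, (∑ j, a i j * w.1 (Fin.castAdd p j) q + b i q - w.2 i q) * w.1 (Fin.natAdd m q) l := by
        rw [Fin.sum_univ_add]
        simp only [hγl, hγr, hx1, hy1, Phi, Fin.append_left, Fin.append_right]
        simp only [add_mul, sub_mul, Finset.sum_add_distrib, Finset.sum_sub_distrib, Finset.sum_mul,
          Finset.mul_sum]
        rw [Finset.sum_comm]
        simp only [mul_assoc]
      rw [e1]
      refine (Finset.abs_sum_le_sum_abs _ _).trans ?_
      calc _ ≤ ∑ q : Fin p, (2:ℝ) ^ (-(k * μ')) * K := Finset.sum_le_sum fun q _ => by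
            rw [abs_mul]
            exact mul_le_mul (herr i q).le (hwK1 _ _) (abs_nonneg _) (by positivity)
        _ = _ := by simp; ring
    refine ⟨γ, ⟨?_, ?_⟩, hγ2⟩
    · refine det_pos_of γ x (1 / (2 ^ k * t)) (by positivity) ?_
      apply hball
      rw [Metric.mem_ball, Prod.dist_eq, max_lt_iff]
      constructor
      · rw [dist_pi_lt_iff hδ]; intro i
        rw [dist_pi_lt_iff hδ]; intro j
        simp only [Z0, hγl, Real.dist_eq]
        obtain ⟨g1, g2⟩ := habR i j
        have h2t : (0:ℝ) < 2 ^ k * t := by positivity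
        have g3 : (a i j : ℝ) * (1 / (2 ^ k * t)) - uu D i j =
            (a i j - 2 ^ k * (t * uu D i j)) / (2 ^ k * t) := by
          field_simp
        rw [g3, abs_of_nonneg (div_nonneg (by linarith) h2t.le)]
        refine lt_of_le_of_lt ?_ htδ
        rw [div_le_div_iff₀ h2t (by linarith)]
        have : a i j - 2 ^ k * (t * uu D i j) ≤ (2:ℝ) ^ k := by linarith
        have ht0 : (0:ℝ) ≤ t := by positivity
        nlinarith
      · rw [dist_pi_lt_iff hδ]; intro i
        rw [dist_pi_lt_iff hδ]; intro l
        exact (hent i l).trans_lt h1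
    · have hγpos : 0 < ‖γ.map (Int.cast : ℤ → ℝ)‖ := by linarith
      refine lt_of_le_of_lt ?_ (h2.trans_le (Real.rpow_le_rpow_of_nonpos hγpos hγC (by linarith)))
      rw [Matrix.norm_le_iff (by positivity)]
      intro i l
      exact hent i l
  refine Set.Infinite.of_image (fun γ : Matrix (Fin (m+p)) (Fin (m+p)) ℤ => ‖γ.map (Int.cast : ℤ → ℝ)‖) ?_
  refine Set.infinite_of_forall_exists_gt fun B => ?_
  obtain ⟨k1, hk1⟩ := pow_unbounded_of_one_lt B (one_lt_two (α := ℝ))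
  obtain ⟨γ, hγ, hγn⟩ := main (max k0 k1) (le_max_left _ _)
  refine ⟨_, ⟨γ, hγ, rfl⟩, hk1.trans_le (le_trans ?_ hγn)⟩
  exact pow_le_pow_right₀ (by norm_num) (le_max_right _ _)

/-- The set of good approximants. -/
def SS {n p : ℕ} (x y : Matrix (Fin n) (Fin p) ℝ) (μ : ℝ) : Set (Matrix (Fin n) (Fin n) ℤ) :=
  {γ | 0 < γ.det ∧
    ‖(γ.map (Int.cast : ℤ → ℝ)) * x - y‖ < ‖γ.map (Int.cast : ℤ → ℝ)‖ ^ (-μ)}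

lemma summable_mat (n : ℕ) : ∃ s : ℝ, 0 < s ∧ ∀ r : ℝ, s ≤ r →
    Summable fun γ : Matrix (Fin n) (Fin n) ℤ => ‖γ.map (Int.cast : ℤ → ℝ)‖ ^ (-r) := by
  let L := Submodule.span ℤ (Set.range (Pi.basisFun ℝ (Fin n × Fin n)))
  refine ⟨Module.finrank ℤ L + 1, by positivity, fun r hr => ?_⟩
  have h := ZLattice.summable_norm_rpow L (-r) (by linarith)
  have hmem : ∀ γ : Matrix (Fin n) (Fin n) ℤ, (fun q : Fin n × Fin n => (γ q.1 q.2 : ℝ)) ∈ L := by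
    intro γ
    rw [Module.Basis.mem_span_iff_repr_mem]
    intro q
    exact ⟨γ q.1 q.2, by simp⟩
  let f : Matrix (Fin n) (Fin n) ℤ → L := fun γ => ⟨_, hmem γ⟩
  have hf : Function.Injective f := by
    intro γ γ' h
    ext i j
    have := congrFun (congrArg Subtype.val h) (i, j)
    simpa [f] using this
  refine (h.comp_injective hf).congr fun γ => ?_
  have : ‖f γ‖ = ‖γ.map (Int.cast : ℤ → ℝ)‖ := by
    apply le_antisymm
    · refine (pi_norm_le_iff_of_nonneg (norm_nonneg _)).2 fun q => ?_
      exact Matrix.norm_entry_le_entrywise_sup_norm (γ.map (Int.cast : ℤ → ℝ)) (i := q.1) (j := q.2)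
    · rw [Matrix.norm_le_iff (norm_nonneg _)]
      intro i j
      exact norm_le_pi_norm (f γ : Fin n × Fin n → ℝ) (i, j)
  simp only [Function.comp, this]

lemma norm_ge_one {n : ℕ} (hn : 0 < n) (γ : Matrix (Fin n) (Fin n) ℤ) (h : 0 < γ.det) :
    1 ≤ ‖γ.map (Int.cast : ℤ → ℝ)‖ := by
  have hne : γ ≠ 0 := by
    rintro rfl
    have : Nonempty (Fin n) := ⟨⟨0, hn⟩⟩
    simp at h
  obtain ⟨i, j, hij⟩ : ∃ i j, γ i j ≠ 0 := by
    by_contra! hc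
    exact hne (by ext i j; simp [hc])
  refine le_trans ?_ (Matrix.norm_entry_le_entrywise_sup_norm _ (i := i) (j := j))
  rw [Matrix.map_apply, Real.norm_eq_abs]
  exact_mod_cast Int.one_le_abs hij

lemma upper (n p : ℕ) (hn : 0 < n) (hp : 0 < p) : ∃ μ0 : ℝ,
    ∀ᵐ z : (Fin n → Fin p → ℝ) × (Fin n → Fin p → ℝ),
      (SS z.1 z.2 μ0).Finite := by
  obtain ⟨μ0, hμ0, hsum⟩ := summable_mat n
  have : Countable (Matrix (Fin n) (Fin n) ℤ) := inferInstanceAs (Countable (Fin n → Fin n → ℤ))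
  refine ⟨μ0, ?_⟩
  have : Nonempty (Fin n) := ⟨⟨0, hn⟩⟩
  have : Nonempty (Fin p) := ⟨⟨0, hp⟩⟩
  let d := Module.finrank ℝ (Fin n → Fin p → ℝ)
  have hd : 1 ≤ d := Module.finrank_pos
  let mul : Matrix (Fin n) (Fin n) ℤ → (Fin n → Fin p → ℝ) → (Fin n → Fin p → ℝ) :=
    fun γ x i l => ∑ s, (γ i s : ℝ) * x s l
  let R : Matrix (Fin n) (Fin n) ℤ → ℝ := fun γ => ‖γ.map (Int.cast : ℤ → ℝ)‖ ^ (-μ0)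
  have hR : ∀ γ, 0 ≤ R γ := fun γ => by positivity
  let V : Matrix (Fin n) (Fin n) ℤ → Set ((Fin n → Fin p → ℝ) × (Fin n → Fin p → ℝ)) :=
    fun γ => {z | 0 < γ.det ∧ ‖mul γ z.1 - z.2‖ < R γ}
  have hVm : ∀ γ, MeasurableSet (V γ) := by
    intro γ
    by_cases hγ : 0 < γ.det
    · have : V γ = {z | ‖mul γ z.1 - z.2‖ < R γ} := by ext z; simp [V, hγ]
      rw [this]
      apply IsOpen.measurableSet
      apply isOpen_lt _ continuous_const
      simp only [mul]
      fun_prop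
    · have : V γ = ∅ := by ext z; simp [V, hγ]
      rw [this]; exact MeasurableSet.empty
  have hfin_iff : ∀ z, z ∈ Filter.limsup V Filter.cofinite ↔ {γ | z ∈ V γ}.Infinite := by
    intro z
    rw [Filter.mem_limsup_iff_frequently_mem, Filter.frequently_cofinite_iff_infinite]
  have hlm : MeasurableSet (Filter.limsup V Filter.cofinite) := by
    have : Filter.limsup V Filter.cofinite =
        ⋂ F : Finset (Matrix (Fin n) (Fin n) ℤ), ⋃ γ : Matrix (Fin n) (Fin n) ℤ, ⋃ _ : γ ∉ F, V γ := by
      ext z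
      rw [hfin_iff]
      simp only [Set.mem_iInter, Set.mem_iUnion]
      constructor
      · intro h F
        obtain ⟨γ, h1, h2⟩ := h.exists_notMem_finset F
        exact ⟨γ, h2, h1⟩
      · intro h hf
        obtain ⟨γ, h2, h1⟩ := h hf.toFinset
        exact h2 (hf.mem_toFinset.2 h1)
    rw [this]
    exact MeasurableSet.iInter fun F => MeasurableSet.iUnion fun γ => MeasurableSet.iUnion fun _ => hVm γ
  have h0 : (volume : Measure ((Fin n → Fin p → ℝ) × (Fin n → Fin p → ℝ)))
      (Filter.limsup V Filter.cofinite) = 0 := by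
    refine (Measure.measure_prod_null hlm).2 (Filter.Eventually.of_forall fun x => ?_)
    let W : Matrix (Fin n) (Fin n) ℤ → Set (Fin n → Fin p → ℝ) := fun γ => Prod.mk x ⁻¹' V γ
    have hW : Prod.mk x ⁻¹' Filter.limsup V Filter.cofinite = Filter.limsup W Filter.cofinite := by
      ext y
      rw [Set.mem_preimage, Filter.mem_limsup_iff_frequently_mem,
        Filter.mem_limsup_iff_frequently_mem]
      rfl
    simp only [hW, Pi.zero_apply]
    apply measure_limsup_cofinite_eq_zero
    have hbd : ∀ γ, volume (W γ) ≤ ENNReal.ofReal (R γ ^ d) * volume (Metric.ball (0 : Fin n → Fin p → ℝ) 1) := by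
      intro γ
      rw [← Measure.addHaar_ball volume (mul γ x) (hR γ)]
      refine measure_mono ?_
      intro y hy
      rw [Metric.mem_ball, dist_comm, dist_eq_norm]
      exact hy.2
    refine ne_top_of_le_ne_top ?_ (ENNReal.tsum_le_tsum hbd)
    rw [ENNReal.tsum_mul_right]
    refine ENNReal.mul_ne_top ?_ measure_ball_lt_top.ne
    apply Summable.tsum_ofReal_ne_top
    refine (hsum (μ0 * d) ?_).congr fun γ => ?_
    · have : (1:ℝ) ≤ d := by exact_mod_cast hd
      nlinarith
    · simp only [R]
      rw [← Real.rpow_natCast, ← Real.rpow_mul (norm_nonneg _)]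
      congr 1; ring
  filter_upwards [measure_eq_zero_iff_ae_notMem.1 h0] with z hz
  rw [hfin_iff, Set.not_infinite] at hz
  exact hz

lemma final (m p : ℕ) (hm : 0 < m) (hp : 0 < p) :
    ∀ᵐ z : (Fin (m+p) → Fin p → ℝ) × (Fin (m+p) → Fin p → ℝ),
      (m : ℝ) / p ≤ approxExp (n := m+p) (p := p) z.1 z.2 := by
  obtain ⟨μ0, hup⟩ := upper (m+p) p (by omega) hp
  have hp' : (0:ℝ) < p := by exact_mod_cast hp
  have hlow : ∀ᵐ z : EE m p, ∀ q : ℚ × ℚ, 0 ≤ (q.1 : ℝ) → (q.1:ℝ) < q.2 → (q.2:ℝ) < m / p → 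
      (SS z.1 z.2 (q.1:ℝ)).Infinite := by
    rw [ae_all_iff]
    intro q
    by_cases hq : 0 ≤ (q.1 : ℝ) ∧ (q.1:ℝ) < q.2 ∧ (q.2:ℝ) < m / p
    · obtain ⟨h1, h2, h3⟩ := hq
      have hb1 : ∀ᵐ z : EE m p, (bot z.1).det ≠ 0 :=
        Measure.quasiMeasurePreserving_fst.ae (bot_ae m p)
      have hb2 : ∀ᵐ z : EE m p, (bot z.2).det ≠ 0 :=
        Measure.quasiMeasurePreserving_snd.ae (bot_ae m p)
      filter_upwards [Phi_ae (real_bc (m := m) (p := p) q.2 (by linarith) (by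
        rw [lt_div_iff₀ hp'] at h3; linarith)), hb1, hb2] with z hz hz1 hz2 _ _ _
      obtain ⟨w, hw, hwz⟩ := hz hz1
      exact approx hm q.1 q.2 h1 h2 w hw z.1 z.2 hwz hz1 hz2
    · filter_upwards with z h1 h2 h3
      exact absurd ⟨h1, h2, h3⟩ hq
  filter_upwards [hup, hlow] with z hz1 hz2
  have hbdd : BddAbove {μ : ℝ | (SS z.1 z.2 μ).Infinite} := by
    refine ⟨μ0, fun μ hμ => ?_⟩
    by_contra! hlt
    refine hμ (hz1.subset ?_)
    rintro γ ⟨hγ, hγ2⟩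
    refine ⟨hγ, hγ2.trans_le ?_⟩
    exact Real.rpow_le_rpow_of_exponent_le (norm_ge_one (by omega) γ hγ) (by linarith)
  refine le_of_forall_lt fun c hc => ?_
  have hmp : (0:ℝ) < m / p := by positivity
  obtain ⟨q1, hq1, hq1'⟩ := exists_rat_btwn (max_lt hc hmp)
  obtain ⟨q2, hq2, hq2'⟩ := exists_rat_btwn hq1'
  have := le_csSup hbdd (hz2 (q1, q2) ((le_max_right _ _).trans hq1.le) hq2 hq2')
  exact ((le_max_left _ _).trans_lt hq1).trans_le this

end DN

/-- For Lebesgue almost every pair `(x,y) ∈ ℝ^{(n,p)} × ℝ^{(n,p)}`, the exponent of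
approximation satisfies `e(x,y) ≥ (n−p)/p`. -/
theorem dani_nogueira_lower_bound_exponent
    (n p : ℕ) (hn : 2 ≤ n) (hp : 1 ≤ p) (hpn : p ≤ n - 1) :
    ∀ᵐ z : Matrix (Fin n) (Fin p) ℝ × Matrix (Fin n) (Fin p) ℝ,
      ((n : ℝ) - p) / p ≤ approxExp z.1 z.2 := by
  obtain ⟨m, rfl⟩ : ∃ m, n = m + p := ⟨n - p, by omega⟩
  have h := DN.final m p (by omega) (by omega)
  have e : (((m + p : ℕ) : ℝ) - p) / p = m / p := by push_cast; ring
  rw [e]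
  exact h
end

section
/- Let d ≥ 3 and let V = ℝ^d with the sup norm and standard lattice ℤ^d. Let V_1 and V_2 be vector subspaces of V of dimensions d_1 ≥ 2 and d_2 ≥ 1 with V = V_1 ⊕ V_2. Suppose there exist δ ∈ (0, d_2/(d_1 − 1)) and κ ∈ (0,1] such that for every nonzero z ∈ ℤ^d, writing z = u + w with u ∈ V_1 and w ∈ V_2, one has ||u||^{d_1} ||z||^{d_2 + δ} > κ. Set χ = d_1(1+δ)/(d_2 − d_1δ + δ). Let R_1 ⊆ V_1 and R_2 ⊆ V_2 be compact convex sets with nonempty interior in the respective subspaces, and for s, t > 0 define Ω(s,t) = {u + w : u ∈ sR_1, w ∈ tR_2}. Then there exist constants σ > 0 and ε_0 > 0 such that for all 0 < ε < ε_0 and all v ∈ ℝ^d, Ω(ε, σε^{−χ}) ∩ (v + ℤ^d) ≠ ∅. -/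
open Module

lemma aux_cover {d : ℕ} {W : Type*} [NormedAddCommGroup W] [NormedSpace ℝ W]
    (φ : (Fin d → ℝ) →ₗ[ℝ] W)
    (hmin : ∀ z : Fin d → ℝ, (∀ i, ∃ k : ℤ, z i = (k : ℝ)) → z ≠ 0 → 1 ≤ ‖φ z‖)
    (c : ℝ) (hc : 0 < c)
    (hvol : ENNReal.ofReal c ≤ MeasureTheory.volume {z | ‖φ z‖ < 1/3}) (v : Fin d → ℝ) :
    ∃ m : Fin d → ℤ, ‖φ (v + fun i => (m i : ℝ))‖ < 1 / c := by
  by_contra! hcon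
  have hφc : Continuous φ := φ.continuous_of_finiteDimensional
  set L := Submodule.span ℤ (Set.range (Pi.basisFun ℝ (Fin d))) with hL
  have hLmem : ∀ z, z ∈ L ↔ ∀ i, ∃ k : ℤ, z i = (k : ℝ) := by
    intro z
    rw [hL, Basis.mem_span_iff_repr_mem]
    simp [eq_comm]
  set Λ : Set W := φ '' (L : Set (Fin d → ℝ)) with hΛ
  have hne : Λ.Nonempty := ⟨φ 0, 0, L.zero_mem, rfl⟩
  set g : (Fin d → ℝ) → ℝ := fun x => Metric.infDist (φ x) Λ with hg
  have hgc : Continuous g := (Metric.continuous_infDist_pt Λ).comp hφc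
  have hgle : ∀ x y l, l ∈ L → g x ≤ g y + ‖φ (x - y - l)‖ := by
    intro x y l hl
    refine le_of_forall_pos_le_add fun η hη => ?_
    obtain ⟨_, ⟨p, hp, rfl⟩, h2⟩ := (Metric.infDist_lt_iff (r := g y + η) hne).1 (by
      show g y < g y + η
      linarith)
    have h3 : g x ≤ dist (φ x) (φ (p + l)) :=
      Metric.infDist_le_dist_of_mem ⟨_, L.add_mem hp hl, rfl⟩
    have h4 : dist (φ x) (φ (p + l)) ≤ dist (φ y) (φ p) + ‖φ (x - y - l)‖ := by
      rw [dist_eq_norm, dist_eq_norm]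
      have : φ x - φ (p + l) = (φ y - φ p) + φ (x - y - l) := by
        simp only [map_add, map_sub]; abel
      rw [this]; exact norm_add_le _ _
    linarith
  have hg0 : g 0 = 0 := by
    have : g 0 ≤ dist (φ 0) (φ 0) := Metric.infDist_le_dist_of_mem ⟨0, L.zero_mem, rfl⟩
    rw [dist_self] at this
    exact le_antisymm this Metric.infDist_nonneg
  have hgv : 1 / c ≤ g v := by
    refine (Metric.le_infDist hne).2 ?_
    rintro _ ⟨p, hp, rfl⟩
    choose k hk using (hLmem p).1 hp
    have := hcon (fun i => - k i)
    rw [dist_eq_norm, ← map_sub]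
    have h2 : v - p = v + fun i => ((-k i : ℤ) : ℝ) := by
      ext i
      simp [hk, sub_eq_add_neg]
    rw [h2]
    exact this
  set N := ⌊1 / c⌋₊ with hN
  have hNle : (N : ℝ) ≤ 1 / c := Nat.floor_le (by positivity)
  have hNlt : 1 / c < N + 1 := Nat.lt_floor_add_one _
  have hex : ∀ i : Fin (N + 1), ∃ p, g p = (i : ℕ) := by
    intro i
    have : ((i : ℕ) : ℝ) ∈ Set.Icc (g 0) (g v) := by
      refine ⟨by rw [hg0]; positivity, le_trans ?_ (hNle.trans hgv)⟩
      exact_mod_cast Nat.lt_succ_iff.1 i.2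
    exact mem_range_of_exists_le_of_exists_ge hgc ⟨0, this.1⟩ ⟨v, this.2⟩
  choose p hp using hex
  set B : Set (Fin d → ℝ) := {z | ‖φ z‖ < 1/3} with hB
  have hBo : IsOpen B := isOpen_lt (hφc.norm) continuous_const
  -- key separation
  have hsep : ∀ i j x y l, l ∈ L → x ∈ B → y ∈ B → p i + x = p j + y + l → i = j := by
    have key : ∀ i j x y l, l ∈ L → x ∈ B → y ∈ B → p i + x = p j + y + l → 
        ((i : ℕ) : ℝ) < (j : ℕ) + 1 := by
      intro i j x y l hl hx hy h
      have h1 := hgle (p i) (p j) l hl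
      have h2 : p i - p j - l = y - x := by
        have : p i = p j + y + l - x := by rw [← h]; abel
        rw [this]; abel
      rw [h2, hp, hp, map_sub] at h1
      have h3 := norm_sub_le (φ y) (φ x)
      have hx' : ‖φ x‖ < 1/3 := hx
      have hy' : ‖φ y‖ < 1/3 := hy
      linarith
    intro i j x y l hl hx hy h
    have h1 := key i j x y l hl hx hy h
    have h2 := key j i y x (-l) (L.neg_mem hl) hy hx (by rw [h]; abel)
    have h1' : (i : ℕ) < (j : ℕ) + 1 := by exact_mod_cast h1
    have h2' : (j : ℕ) < (i : ℕ) + 1 := by exact_mod_cast h2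
    ext; omega
  set f : Fin (N + 1) → Set (Fin d → ℝ) := fun i => (fun z => -p i + z) ⁻¹' B with hf
  have hfo : ∀ i, IsOpen (f i) := fun i => hBo.preimage (by fun_prop)
  have hdisj : Pairwise (Function.onFun Disjoint f) := by
    intro i j hij
    refine Set.disjoint_left.2 fun z hz hz' => hij ?_
    exact hsep i j _ _ 0 L.zero_mem hz hz' (by simp)
  have hmeas : MeasureTheory.volume (⋃ i, f i) = (N + 1 : ℕ) * MeasureTheory.volume B := by
    rw [MeasureTheory.measure_iUnion hdisj (fun i => (hfo i).measurableSet)]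
    simp [hf, MeasureTheory.measure_preimage_add]
  have hfund := ZSpan.isAddFundamentalDomain' (Pi.basisFun ℝ (Fin d)) MeasureTheory.volume
  have hF : MeasureTheory.volume (ZSpan.fundamentalDomain (Pi.basisFun ℝ (Fin d))) = 1 := by
    rw [ZSpan.fundamentalDomain_pi_basisFun, MeasureTheory.volume_pi_pi]
    simp
  have hlt : MeasureTheory.volume (ZSpan.fundamentalDomain (Pi.basisFun ℝ (Fin d))) 
      < MeasureTheory.volume (⋃ i, f i) := by
    rw [hF, hmeas]
    calc (1 : ENNReal) < ENNReal.ofReal ((N + 1 : ℕ) * c) := by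
          rw [ENNReal.one_lt_ofReal]
          rw [div_lt_iff₀ hc] at hNlt
          push_cast; exact hNlt
      _ = (N + 1 : ℕ) * ENNReal.ofReal c := by
          rw [ENNReal.ofReal_mul (by positivity), ENNReal.ofReal_natCast]
      _ ≤ _ := by gcongr
  have : Countable L.toAddSubgroup := inferInstanceAs (Countable L)
  obtain ⟨x, y, hxy, hd⟩ := MeasureTheory.exists_pair_mem_lattice_not_disjoint_vadd hfund
    (isOpen_iUnion hfo).measurableSet.nullMeasurableSet hlt
  obtain ⟨_, ⟨z, hz, rfl⟩, w, hw, hzw⟩ := Set.not_disjoint_iff.mp hd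
  obtain ⟨i, hi⟩ := Set.mem_iUnion.1 hz
  obtain ⟨j, hj⟩ := Set.mem_iUnion.1 hw
  have hzw' : (y : Fin d → ℝ) + w = x + z := hzw
  have hij : i = j := hsep i j (-p i + z) (-p j + w) ((y : Fin d → ℝ) - x)
      (L.sub_mem y.2 x.2) hi hj (by
    ext t
    have := congrFun hzw' t
    simp only [Pi.add_apply, Pi.sub_apply, Pi.neg_apply] at this ⊢
    linarith)
  subst hij
  have h1 : (y : Fin d → ℝ) - x = (-p i + z) - (-p i + w) := by
    have : w = x + z - y := by rw [← hzw']; abel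
    rw [this]; abel
  have h2 := hmin ((y : Fin d → ℝ) - x) ((hLmem _).1 (L.sub_mem y.2 x.2)) (by
    rw [sub_ne_zero]; exact fun h => hxy (Subtype.ext h.symm))
  rw [h1, map_sub] at h2
  have h3 := norm_sub_le (φ (-p i + z)) (φ (-p i + w))
  have hx' : ‖φ (-p i + z)‖ < 1/3 := hi
  have hy' : ‖φ (-p i + w)‖ < 1/3 := hj
  linarith

noncomputable def auxD {d : ℕ} (V₁ V₂ : Submodule ℝ (Fin d → ℝ)) (h : IsCompl V₁ V₂) (a b : ℝ) :
    (Fin d → ℝ) →ₗ[ℝ] V₁ × V₂ :=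
  (LinearMap.prodMap (a • LinearMap.id) (b • LinearMap.id)) ∘ₗ
    (Submodule.prodEquivOfIsCompl V₁ V₂ h).symm.toLinearMap

lemma aux_vol {d : ℕ} (V₁ V₂ : Submodule ℝ (Fin d → ℝ)) (h : IsCompl V₁ V₂) :
    ∃ c : ℝ, 0 < c ∧ ∀ a b : ℝ, 0 < a → 0 < b →
      ENNReal.ofReal (c * (a ^ (finrank ℝ V₁) * b ^ (finrank ℝ V₂))) ≤
        MeasureTheory.volume {z | ‖auxD V₁ V₂ h a⁻¹ b⁻¹ z‖ < 1/3} := by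
  set e := Submodule.prodEquivOfIsCompl V₁ V₂ h with he
  set B : Set (Fin d → ℝ) := {z | ‖e.symm z‖ < 1/3} with hB
  have hcont : Continuous e.symm := e.symm.toLinearMap.continuous_of_finiteDimensional
  have hBo : IsOpen B := isOpen_lt hcont.norm continuous_const
  have hpos : 0 < MeasureTheory.volume B := hBo.measure_pos _ ⟨0, by simp [hB]⟩
  obtain ⟨c, hc0, hcB⟩ := ENNReal.lt_iff_exists_nnreal_btwn.1 hpos
  refine ⟨c, by exact_mod_cast hc0, fun a b ha hb => ?_⟩
  set D : (V₁ × V₂) →ₗ[ℝ] (V₁ × V₂) := 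
    LinearMap.prodMap (a⁻¹ • LinearMap.id) (b⁻¹ • LinearMap.id) with hD
  set f : (Fin d → ℝ) →ₗ[ℝ] (Fin d → ℝ) := e.toLinearMap ∘ₗ D ∘ₗ e.symm.toLinearMap with hf
  have hdet : LinearMap.det f = (a ^ (finrank ℝ V₁) * b ^ (finrank ℝ V₂))⁻¹ := by
    rw [hf, LinearMap.det_conj, hD, LinearMap.det_prodMap, LinearMap.det_smul, LinearMap.det_smul]
    simp [mul_comm]
  have hset : {z | ‖auxD V₁ V₂ h a⁻¹ b⁻¹ z‖ < 1/3} = f ⁻¹' B := by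
    ext z
    simp [hB, hf, auxD, hD, ← he]
  rw [hset, MeasureTheory.Measure.addHaar_preimage_linearMap _ (by rw [hdet]; positivity), hdet,
    inv_inv, abs_of_pos (by positivity), mul_comm, ENNReal.ofReal_mul (by positivity)]
  gcongr
  rw [ENNReal.ofReal_coe_nnreal]
  exact hcB.le

lemma aux_num (n₁ n₂ δ κ c r₁ r₂ χ : ℝ) (h1 : 2 ≤ n₁) (h2 : 1 ≤ n₂) (hδ : 0 < δ)
    (hδ1 : δ < n₂ / (n₁ - 1)) (hκ0 : 0 < κ) (hκ1 : κ ≤ 1) (hc : 0 < c) (hr₁ : 0 < r₁)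
    (hr₂ : 0 < r₂) (hχ : χ = n₁ * (1 + δ) / (n₂ - n₁ * δ + δ)) :
    ∃ σ > (0 : ℝ), ∃ ε₀ > (0 : ℝ), ∀ ε : ℝ, 0 < ε → ε < ε₀ → ∃ a b : ℝ, 0 < a ∧ 0 < b ∧ a ≤ b ∧
      a ^ n₁ * (2 * b) ^ (n₂ + δ) ≤ κ ∧
      1 / (c * (a ^ n₁ * b ^ n₂)) * a ≤ r₁ * ε ∧
      1 / (c * (a ^ n₁ * b ^ n₂)) * b ≤ r₂ * (σ * ε ^ (-χ)) := by
  have hE : 0 < n₂ - n₁ * δ + δ := by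
    rw [lt_div_iff₀ (by linarith)] at hδ1
    linarith
  set E := n₂ - n₁ * δ + δ with hEdef
  have hn : 0 < n₁ := by linarith
  set κ₂ := κ / 2 ^ (n₂ + δ) with hκ₂
  have hκ₂0 : 0 < κ₂ := by positivity
  have hκ₂1 : κ₂ ≤ 1 := by
    rw [hκ₂, div_le_one (by positivity)]
    exact hκ1.trans (Real.one_le_rpow (by norm_num) (by linarith))
  set κ₁ := κ₂ ^ (1 / n₁) with hκ₁
  have hκ₁0 : 0 < κ₁ := by positivity
  have hκ₁1 : κ₁ ≤ 1 := Real.rpow_le_one hκ₂0.le hκ₂1 (by positivity)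
  have hκ12 : κ₁ ^ n₁ = κ₂ := by
    rw [hκ₁, ← Real.rpow_mul hκ₂0.le, one_div_mul_cancel hn.ne', Real.rpow_one]
  set Q := κ₁ / (c * κ₂ * r₁) with hQ
  have hQ0 : 0 < Q := by positivity
  set l := Q ^ (n₁ / E) with hl
  have hl0 : 0 < l := by positivity
  refine ⟨l ^ (1 + δ) / (c * κ₂ * r₂), by positivity, l ^ (E / n₁), by positivity, ?_⟩
  intro ε hε hε0
  set b := l * ε ^ (-(n₁ / E)) with hb
  have hb0 : 0 < b := by positivity
  have hb1 : 1 ≤ b := by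
    have : ε ^ (n₁ / E) ≤ (l ^ (E / n₁)) ^ (n₁ / E) :=
      Real.rpow_le_rpow hε.le hε0.le (by positivity)
    rw [← Real.rpow_mul hl0.le, show E / n₁ * (n₁ / E) = 1 by field_simp, Real.rpow_one] at this
    rw [hb, Real.rpow_neg hε.le, ← div_eq_mul_inv, one_le_div (by positivity)]
    exact this
  set a := κ₁ * b ^ (-((n₂ + δ) / n₁)) with ha
  have ha0 : 0 < a := by positivity
  have han : a ^ n₁ = κ₂ * b ^ (-(n₂ + δ)) := by
    rw [ha, Real.mul_rpow hκ₁0.le (by positivity), hκ12, ← Real.rpow_mul hb0.le]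
    congr 2
    field_simp
  have hab : a ^ n₁ * b ^ n₂ = κ₂ * b ^ (-δ) := by
    rw [han, mul_assoc, ← Real.rpow_add hb0]
    congr 2; ring
  have hM : 1 / (c * (a ^ n₁ * b ^ n₂)) = b ^ δ / (c * κ₂) := by
    rw [hab, Real.rpow_neg hb0.le]
    field_simp
  refine ⟨a, b, ha0, hb0, ?_, ?_, ?_, ?_⟩
  · have : b ^ (-((n₂ + δ) / n₁)) ≤ 1 := by
      apply Real.rpow_le_one_of_one_le_of_nonpos hb1
      have : 0 < (n₂ + δ) / n₁ := by positivity
      linarith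
    have : a ≤ 1 := by
      rw [ha]; exact mul_le_one₀ hκ₁1 (by positivity) this
    linarith
  · rw [han, Real.mul_rpow (by norm_num) hb0.le, hκ₂, Real.rpow_neg hb0.le]
    apply le_of_eq
    field_simp
  · rw [hM]
    have h5 : b ^ δ * b ^ (-((n₂ + δ) / n₁)) = Q⁻¹ * ε := by
      rw [← Real.rpow_add hb0, hb, Real.mul_rpow hl0.le (by positivity), hl,
        ← Real.rpow_mul hQ0.le, ← Real.rpow_mul hε.le]
      rw [show n₁ / E * (δ + -((n₂ + δ) / n₁)) = -1 by
        rw [div_mul_eq_mul_div, div_eq_iff hE.ne', hEdef]; field_simp; ring]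
      rw [show -(n₁ / E) * (δ + -((n₂ + δ) / n₁)) = 1 by
        rw [neg_mul, div_mul_eq_mul_div, neg_eq_iff_eq_neg, div_eq_iff hE.ne', hEdef]
        field_simp; ring]
      rw [Real.rpow_neg_one, Real.rpow_one]
    have : b ^ δ / (c * κ₂) * a = κ₁ / (c * κ₂) * (b ^ δ * b ^ (-((n₂ + δ) / n₁))) := by
      rw [ha]; ring
    rw [this, h5, hQ]
    apply le_of_eq
    field_simp
  · rw [hM]
    have h5 : b ^ δ * b = l ^ (1 + δ) * ε ^ (-χ) := by
      rw [← Real.rpow_add_one hb0.ne', hb, Real.mul_rpow hl0.le (by positivity),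
        ← Real.rpow_mul hε.le, hχ, add_comm δ 1]
      congr 2
      field_simp
    have : b ^ δ / (c * κ₂) * b = (b ^ δ * b) / (c * κ₂) := by ring
    rw [this, h5]
    apply le_of_eq
    field_simp



/-- **Proposition 2.1.** Let `V = ℝ^d` (`d ≥ 3`) with the sup norm, `V₁, V₂` complementary
subspaces of dimensions `d₁ ≥ 2`, `d₂ ≥ 1`. Suppose there are `δ ∈ (0, d₂/(d₁−1))` and
`κ ∈ (0,1]` such that every nonzero integer vector `z = u + w` (`u ∈ V₁`, `w ∈ V₂`)
satisfies `‖u‖^{d₁}‖z‖^{d₂+δ} > κ`. Let `χ = d₁(1+δ)/(d₂ − d₁δ + δ)`, and let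
`R₁ ⊆ V₁`, `R₂ ⊆ V₂` be compact convex sets with nonempty interior in the respective
subspaces. Then there are `σ > 0` and `ε₀ > 0` such that for all `0 < ε < ε₀` and all
`v ∈ ℝ^d`, the set `Ω(ε, σε^{−χ}) = εR₁ + σε^{−χ}R₂` meets the affine lattice `v + ℤ^d`. -/
theorem affine_lattice_in_parallelopiped
    (d : ℕ) (hd : 3 ≤ d)
    (V₁ V₂ : Submodule ℝ (Fin d → ℝ))
    (d₁ d₂ : ℕ) (hd₁ : finrank ℝ V₁ = d₁) (hd₂ : finrank ℝ V₂ = d₂)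
    (hd₁2 : 2 ≤ d₁) (hd₂1 : 1 ≤ d₂)
    (hcompl : IsCompl V₁ V₂)
    (δ κ : ℝ) (hδ0 : 0 < δ) (hδ1 : δ < (d₂ : ℝ) / ((d₁ : ℝ) - 1))
    (hκ0 : 0 < κ) (hκ1 : κ ≤ 1)
    (hgap : ∀ z : Fin d → ℝ, (∀ i, ∃ k : ℤ, z i = (k : ℝ)) → z ≠ 0 →
      ∀ u ∈ V₁, ∀ w ∈ V₂, z = u + w →
        κ < ‖u‖ ^ (d₁ : ℝ) * ‖z‖ ^ ((d₂ : ℝ) + δ))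
    (χ : ℝ) (hχ : χ = (d₁ : ℝ) * (1 + δ) / ((d₂ : ℝ) - (d₁ : ℝ) * δ + δ))
    (R₁ R₂ : Set (Fin d → ℝ))
    (hR₁V : R₁ ⊆ (V₁ : Set (Fin d → ℝ))) (hR₂V : R₂ ⊆ (V₂ : Set (Fin d → ℝ)))
    (hR₁c : IsCompact R₁) (hR₂c : IsCompact R₂)
    (hR₁conv : Convex ℝ R₁) (hR₂conv : Convex ℝ R₂)
    (hR₁int : (interior {v : V₁ | (v : Fin d → ℝ) ∈ R₁}).Nonempty)
    (hR₂int : (interior {v : V₂ | (v : Fin d → ℝ) ∈ R₂}).Nonempty) :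
    ∃ σ > (0 : ℝ), ∃ ε₀ > (0 : ℝ), ∀ ε : ℝ, 0 < ε → ε < ε₀ → ∀ v : Fin d → ℝ,
      ∃ m : Fin d → ℤ, ∃ u ∈ R₁, ∃ w ∈ R₂,
        v + (fun i => ((m i : ℝ))) = ε • u + (σ * ε ^ (-χ)) • w := by
  obtain ⟨c, hc, hvol⟩ := aux_vol V₁ V₂ hcompl
  obtain ⟨c₁, hc₁⟩ := hR₁int
  obtain ⟨c₂, hc₂⟩ := hR₂int
  obtain ⟨r₁, hr₁, hb₁⟩ := Metric.isOpen_iff.1 isOpen_interior c₁ hc₁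
  obtain ⟨r₂, hr₂, hb₂⟩ := Metric.isOpen_iff.1 isOpen_interior c₂ hc₂
  obtain ⟨σ, hσ, ε₀, hε₀, H⟩ := aux_num d₁ d₂ δ κ c r₁ r₂ χ (by exact_mod_cast hd₁2)
    (by exact_mod_cast hd₂1) hδ0 hδ1 hκ0 hκ1 hc hr₁ hr₂ hχ
  refine ⟨σ, hσ, ε₀, hε₀, fun ε hε hεlt v => ?_⟩
  obtain ⟨a, b, ha, hb, hab, hκ, hMa, hMb⟩ := H ε hε hεlt
  have hT : 0 < σ * ε ^ (-χ) := by positivity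
  set T := σ * ε ^ (-χ) with hTdef
  set e := Submodule.prodEquivOfIsCompl V₁ V₂ hcompl with he
  set φ := auxD V₁ V₂ hcompl a⁻¹ b⁻¹ with hφ
  have hφ1 : ∀ z, ‖(e.symm z).1‖ ≤ a * ‖φ z‖ := by
    intro z
    have : ‖(φ z).1‖ ≤ ‖φ z‖ := norm_fst_le _
    have h2 : (φ z).1 = a⁻¹ • (e.symm z).1 := by simp [hφ, auxD, he]
    rw [h2, norm_smul, Real.norm_of_nonneg (by positivity), inv_mul_le_iff₀ ha] at this
    exact this
  have hφ2 : ∀ z, ‖(e.symm z).2‖ ≤ b * ‖φ z‖ := by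
    intro z
    have : ‖(φ z).2‖ ≤ ‖φ z‖ := norm_snd_le _
    have h2 : (φ z).2 = b⁻¹ • (e.symm z).2 := by simp [hφ, auxD, he]
    rw [h2, norm_smul, Real.norm_of_nonneg (by positivity), inv_mul_le_iff₀ hb] at this
    exact this
  have hdec : ∀ z, z = ((e.symm z).1 : Fin d → ℝ) + ((e.symm z).2 : Fin d → ℝ) := by
    intro z
    conv_lhs => rw [← e.apply_symm_apply z]
    rfl
  have hv := hvol a b ha hb
  rw [hd₁, hd₂, ← Real.rpow_natCast, ← Real.rpow_natCast] at hv
  have hmin : ∀ z : Fin d → ℝ, (∀ i, ∃ k : ℤ, z i = (k : ℝ)) → z ≠ 0 → 1 ≤ ‖φ z‖ := by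
    intro z hz hz0
    by_contra! hlt
    have h1 := hgap z hz hz0 _ (e.symm z).1.2 _ (e.symm z).2.2 (hdec z)
    have hu : ‖((e.symm z).1 : Fin d → ℝ)‖ ≤ a :=
      (hφ1 z).trans (mul_le_of_le_one_right ha.le hlt.le)
    have hw : ‖((e.symm z).2 : Fin d → ℝ)‖ ≤ b :=
      (hφ2 z).trans (mul_le_of_le_one_right hb.le hlt.le)
    have hzn : ‖z‖ ≤ 2 * b := by
      have := norm_add_le ((e.symm z).1 : Fin d → ℝ) ((e.symm z).2 : Fin d → ℝ)
      rw [← hdec z] at this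
      linarith
    have h2 : ‖((e.symm z).1 : Fin d → ℝ)‖ ^ (d₁ : ℝ) * ‖z‖ ^ ((d₂ : ℝ) + δ) ≤
        a ^ (d₁ : ℝ) * (2 * b) ^ ((d₂ : ℝ) + δ) := by
      gcongr
    linarith
  obtain ⟨m, hm⟩ := aux_cover φ hmin _ (by positivity) hv
    (v - ε • (c₁ : Fin d → ℝ) - T • (c₂ : Fin d → ℝ))
  set z := v - ε • (c₁ : Fin d → ℝ) - T • (c₂ : Fin d → ℝ) + fun i => (m i : ℝ) with hz
  have hu : ‖(e.symm z).1‖ < r₁ * ε := by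
    refine lt_of_le_of_lt (hφ1 z) (lt_of_lt_of_le ?_ hMa)
    rw [mul_comm]; gcongr
  have hw : ‖(e.symm z).2‖ < r₂ * T := by
    refine lt_of_le_of_lt (hφ2 z) (lt_of_lt_of_le ?_ hMb)
    rw [mul_comm]; gcongr
  have m1 : c₁ + ε⁻¹ • (e.symm z).1 ∈ Metric.ball c₁ r₁ := by
    rw [mem_ball_iff_norm, add_sub_cancel_left, norm_smul, Real.norm_of_nonneg (by positivity),
      inv_mul_lt_iff₀ hε, mul_comm]
    exact hu
  have m2 : c₂ + T⁻¹ • (e.symm z).2 ∈ Metric.ball c₂ r₂ := by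
    rw [mem_ball_iff_norm, add_sub_cancel_left, norm_smul, Real.norm_of_nonneg (by positivity),
      inv_mul_lt_iff₀ hT, mul_comm]
    exact hw
  refine ⟨m, ((c₁ + ε⁻¹ • (e.symm z).1 : V₁) : Fin d → ℝ), ?_,
    ((c₂ + T⁻¹ • (e.symm z).2 : V₂) : Fin d → ℝ), ?_, ?_⟩
  · have := interior_subset (hb₁ m1)
    exact this
  · have := interior_subset (hb₂ m2)
    exact this
  have h9 := hdec z
  push_cast
  rw [smul_add, smul_add, smul_inv_smul₀ hε.ne', smul_inv_smul₀ hT.ne']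
  have : v + (fun i => (m i : ℝ)) = z + ε • (c₁ : Fin d → ℝ) + T • (c₂ : Fin d → ℝ) := by
    rw [hz]; abel
  rw [this]
  conv_lhs => rw [h9]
  abel
end

section
/- Let n ≥ 2, 1 ≤ p ≤ n−1 and q = n−p. Let ξ be a real q×p matrix, θ an invertible real p×p matrix, and let x ∈ ℝ^{(n,p)} be the n×p matrix formed by stacking ξθ on top of θ. Then the homogeneous exponent of x equals the classical Diophantine exponent of ξ: h(x) = e(ξ). -/
open Matrix

attribute [local instance] Matrix.normedAddCommGroup

/-- The homogeneous exponent `h(x)` of `x ∈ ℝ^{(n,p)}`: the infimum of `u ∈ ℝ` for which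
there exists `c > 0` such that `‖ωx‖ > c‖ω‖^{−u}` for all nonzero `ω ∈ M(n,ℤ)`. -/
noncomputable def homExp {n p : ℕ} (x : Matrix (Fin n) (Fin p) ℝ) : ℝ :=
  sInf {u : ℝ | ∃ c > (0 : ℝ), ∀ ω : Matrix (Fin n) (Fin n) ℤ, ω ≠ 0 →
    c * ‖ω.map (Int.cast : ℤ → ℝ)‖ ^ (-u) < ‖(ω.map (Int.cast : ℤ → ℝ)) * x‖}

/-- `d(α) = inf_{β ∈ M(p,ℤ)} ‖αξ + β‖` for a `p×q` integer matrix `α` and a real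
`q×p` matrix `ξ`. -/
noncomputable def dval {p q : ℕ} (ξ : Matrix (Fin q) (Fin p) ℝ)
    (α : Matrix (Fin p) (Fin q) ℤ) : ℝ :=
  sInf {r : ℝ | ∃ β : Matrix (Fin p) (Fin p) ℤ,
    r = ‖(α.map (Int.cast : ℤ → ℝ)) * ξ + β.map (Int.cast : ℤ → ℝ)‖}

/-- The classical Diophantine exponent `e(ξ)` of a real `q×p` matrix `ξ`: the supremum of
all `a` such that `d(α) < ‖α‖^{−a}` for infinitely many nonzero `p×q` integer matrices. -/
noncomputable def dioExp {p q : ℕ} (ξ : Matrix (Fin q) (Fin p) ℝ) : ℝ :=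
  sSup {a : ℝ | {α : Matrix (Fin p) (Fin q) ℤ | α ≠ 0 ∧
    dval ξ α < ‖α.map (Int.cast : ℤ → ℝ)‖ ^ (-a)}.Infinite}


namespace HomDio

abbrev rc {m n : ℕ} (α : Matrix (Fin m) (Fin n) ℤ) : Matrix (Fin m) (Fin n) ℝ :=
  α.map (Int.cast : ℤ → ℝ)

lemma entry_le {m n : ℕ} (M : Matrix (Fin m) (Fin n) ℝ) (i : Fin m) (j : Fin n) :
    |M i j| ≤ ‖M‖ := by
  rw [← Real.norm_eq_abs]; exact Matrix.norm_entry_le_entrywise_sup_norm M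

lemma norm_le_of {m n : ℕ} (M : Matrix (Fin m) (Fin n) ℝ) {r : ℝ} (hr : 0 ≤ r)
    (h : ∀ i j, |M i j| ≤ r) : ‖M‖ ≤ r :=
  (Matrix.norm_le_iff hr).2 (fun i j => by rw [Real.norm_eq_abs]; exact h i j)

lemma norm_mul_le' {m n k : ℕ} (M : Matrix (Fin m) (Fin n) ℝ) (N : Matrix (Fin n) (Fin k) ℝ) :
    ‖M * N‖ ≤ n * ‖M‖ * ‖N‖ := by
  refine norm_le_of _ (by positivity) (fun i j => ?_)
  rw [Matrix.mul_apply]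
  calc |∑ l, M i l * N l j| ≤ ∑ l, |M i l * N l j| := Finset.abs_sum_le_sum_abs _ _
    _ ≤ ∑ _l : Fin n, ‖M‖ * ‖N‖ := by
        refine Finset.sum_le_sum (fun l _ => ?_)
        rw [abs_mul]
        exact mul_le_mul (entry_le _ _ _) (entry_le _ _ _) (abs_nonneg _) (norm_nonneg _)
    _ = n * ‖M‖ * ‖N‖ := by simp [mul_assoc]

lemma one_le_norm {m n : ℕ} {α : Matrix (Fin m) (Fin n) ℤ} (h : α ≠ 0) : 1 ≤ ‖rc α‖ := by
  by_contra hc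
  apply h
  ext i j
  by_contra h0
  apply hc
  refine le_trans ?_ (entry_le (rc α) i j)
  have : (1:ℤ) ≤ |α i j| := Int.one_le_abs h0
  simp only [rc, Matrix.map_apply]
  exact_mod_cast this

lemma finite_le {m n : ℕ} (R : ℝ) : {α : Matrix (Fin m) (Fin n) ℤ | ‖rc α‖ ≤ R}.Finite := by
  have hf : (Set.pi Set.univ (fun _ : Fin m => Set.pi Set.univ
      (fun _ : Fin n => Set.Icc (-⌈R⌉) ⌈R⌉))).Finite :=
    Set.Finite.pi (fun _ => Set.Finite.pi (fun _ => Set.finite_Icc _ _))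
  refine hf.subset (fun α hα => ?_)
  intro i _ j _
  have h1 := (entry_le (rc α) i j).trans (le_trans hα (Int.le_ceil R))
  change |((α i j : ℤ) : ℝ)| ≤ _ at h1
  have h2 : |α i j| ≤ ⌈R⌉ := by exact_mod_cast h1
  exact abs_le.1 h2

lemma dval_le {p q : ℕ} (ξ : Matrix (Fin q) (Fin p) ℝ) (α : Matrix (Fin p) (Fin q) ℤ)
    (β : Matrix (Fin p) (Fin p) ℤ) : dval ξ α ≤ ‖rc α * ξ + rc β‖ :=
  csInf_le ⟨0, by rintro r ⟨b, rfl⟩; exact norm_nonneg _⟩ ⟨β, rfl⟩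

lemma dval_attained {p q : ℕ} (ξ : Matrix (Fin q) (Fin p) ℝ) (α : Matrix (Fin p) (Fin q) ℤ) :
    ∃ β : Matrix (Fin p) (Fin p) ℤ, dval ξ α = ‖rc α * ξ + rc β‖ ∧ dval ξ α ≤ 1 / 2 := by
  let β : Matrix (Fin p) (Fin p) ℤ := Matrix.of fun i j => - round ((rc α * ξ) i j)
  have hb : ∀ i j, (rc α * ξ + rc β) i j = (rc α * ξ) i j - round ((rc α * ξ) i j) := by
    intro i j
    simp [β, rc, sub_eq_add_neg]
  refine ⟨β, le_antisymm (dval_le ξ α β) ?_, (dval_le ξ α β).trans ?_⟩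
  · refine le_csInf ⟨_, β, rfl⟩ ?_
    rintro r ⟨b, rfl⟩
    refine norm_le_of _ (norm_nonneg _) (fun i j => ?_)
    rw [hb]
    refine le_trans ?_ (entry_le _ i j)
    have := round_le ((rc α * ξ) i j) (- b i j)
    simpa [rc] using this
  · refine norm_le_of _ (by norm_num) (fun i j => ?_)
    rw [hb]
    exact abs_sub_round _

lemma dval_nonneg {p q : ℕ} (ξ : Matrix (Fin q) (Fin p) ℝ) (α : Matrix (Fin p) (Fin q) ℤ) :
    0 ≤ dval ξ α := by
  obtain ⟨β, h, _⟩ := dval_attained ξ α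
  rw [h]; exact norm_nonneg _

lemma smul_inj {p q : ℕ} {α : Matrix (Fin p) (Fin q) ℤ} (h : α ≠ 0) :
    Function.Injective (fun k : ℕ => ((k : ℤ) + 1) • α) := by
  have : ∃ i j, α i j ≠ 0 := by
    by_contra hc; push Not at hc; exact h (by ext i j; exact hc i j)
  obtain ⟨i, j, hij⟩ := this
  intro k l hkl
  have h2 := congrFun (congrFun hkl i) j
  simp only [Matrix.smul_apply, smul_eq_mul] at h2
  have := mul_right_cancel₀ hij h2
  omega

def SA {p q : ℕ} (ξ : Matrix (Fin q) (Fin p) ℝ) (a : ℝ) : Set (Matrix (Fin p) (Fin q) ℤ) :=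
  {α : Matrix (Fin p) (Fin q) ℤ | α ≠ 0 ∧
    dval ξ α < ‖α.map (Int.cast : ℤ → ℝ)‖ ^ (-a)}

lemma exists_ne {p q : ℕ} (hp : 1 ≤ p) (hq : 1 ≤ q) : ∃ α : Matrix (Fin p) (Fin q) ℤ, α ≠ 0 := by
  refine ⟨Matrix.of fun _ _ => 1, fun h => ?_⟩
  have := congrFun (congrFun h ⟨0, hp⟩) ⟨0, hq⟩
  simp at this

lemma SA_nonpos {p q : ℕ} (hp : 1 ≤ p) (hq : 1 ≤ q) (ξ : Matrix (Fin q) (Fin p) ℝ) {a : ℝ}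
    (ha : a ≤ 0) : (SA ξ a).Infinite := by
  obtain ⟨α, h⟩ := exists_ne hp hq
  refine Set.infinite_of_injective_forall_mem (smul_inj h) (fun k => ?_)
  have hne : ((k : ℤ) + 1) • α ≠ 0 := smul_ne_zero (by omega) h
  refine ⟨hne, ?_⟩
  obtain ⟨β, _, h2⟩ := dval_attained ξ (((k : ℤ) + 1) • α)
  have := Real.one_le_rpow (one_le_norm hne) (by linarith : 0 ≤ -a)
  simp only [rc] at this
  linarith

lemma dval_pos_of {p q : ℕ} (ξ : Matrix (Fin q) (Fin p) ℝ) {a : ℝ}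
    (ha : (SA ξ a).Finite) {α : Matrix (Fin p) (Fin q) ℤ} (h : α ≠ 0) : 0 < dval ξ α := by
  rcases (dval_nonneg ξ α).lt_or_eq with h0 | h0
  · exact h0
  exfalso
  refine Set.infinite_of_injective_forall_mem (smul_inj h) (fun k => ?_) ha
  have hne : ((k : ℤ) + 1) • α ≠ 0 := smul_ne_zero (by omega) h
  refine ⟨hne, ?_⟩
  obtain ⟨β, h1, _⟩ := dval_attained ξ α
  rw [← h0] at h1
  have h3 : rc α * ξ + rc β = 0 := norm_eq_zero.1 h1.symm
  have h4 : rc (((k : ℤ) + 1) • α) * ξ + rc (((k : ℤ) + 1) • β) = 0 := by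
    have e1 : rc (((k : ℤ) + 1) • α) = ((k : ℝ) + 1) • rc α := by ext i j; simp [rc]
    have e2 : rc (((k : ℤ) + 1) • β) = ((k : ℝ) + 1) • rc β := by
      ext i j
      simp only [rc, Matrix.map_apply, Matrix.smul_apply, smul_eq_mul]
      push_cast
      ring
    rw [e1, e2, Matrix.smul_mul, ← smul_add, h3, smul_zero]
  have h5 := dval_le ξ (((k : ℤ) + 1) • α) (((k : ℤ) + 1) • β)
  rw [h4, norm_zero] at h5
  exact h5.trans_lt (Real.rpow_pos_of_pos (lt_of_lt_of_le one_pos (one_le_norm hne)) _)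

lemma lower_bound {p q : ℕ} (ξ : Matrix (Fin q) (Fin p) ℝ) {a : ℝ}
    (ha : (SA ξ a).Finite) : ∃ c > 0, c ≤ 1 ∧ ∀ α : Matrix (Fin p) (Fin q) ℤ, α ≠ 0 →
      c * ‖rc α‖ ^ (-a) ≤ dval ξ α := by
  have hpos : ∀ α : Matrix (Fin p) (Fin q) ℤ, α ≠ 0 → 0 < ‖rc α‖ ^ (-a) := fun α h =>
    Real.rpow_pos_of_pos (lt_of_lt_of_le one_pos (one_le_norm h)) _
  have main : ∃ c > 0, ∀ α ∈ SA ξ a, c ≤ dval ξ α / ‖rc α‖ ^ (-a) := by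
    rcases (SA ξ a).eq_empty_or_nonempty with he | hne
    · exact ⟨1, one_pos, by simp [he]⟩
    · obtain ⟨α, hα, hm⟩ := Set.exists_min_image _ (fun α => dval ξ α / ‖rc α‖ ^ (-a)) ha hne
      exact ⟨_, div_pos (dval_pos_of ξ ha hα.1) (hpos α hα.1), hm⟩
  obtain ⟨c, hc, hm⟩ := main
  refine ⟨min c 1, lt_min hc one_pos, min_le_right _ _, fun α h => ?_⟩
  by_cases hα : α ∈ SA ξ a
  · have := hm α hα
    rw [le_div_iff₀ (hpos α h)] at this
    exact (mul_le_mul_of_nonneg_right (min_le_left _ _) (hpos α h).le).trans this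
  · have h1 : ‖rc α‖ ^ (-a) ≤ dval ξ α := by
      by_contra hc
      exact hα ⟨h, not_le.1 hc⟩
    refine le_trans ?_ h1
    exact mul_le_of_le_one_left (hpos α h).le (min_le_right _ _)

def HU {n p : ℕ} (x : Matrix (Fin n) (Fin p) ℝ) : Set ℝ :=
  {u : ℝ | ∃ c > (0 : ℝ), ∀ ω : Matrix (Fin n) (Fin n) ℤ, ω ≠ 0 →
    c * ‖ω.map (Int.cast : ℤ → ℝ)‖ ^ (-u) < ‖(ω.map (Int.cast : ℤ → ℝ)) * x‖}

section
variable {p q : ℕ} (ξ : Matrix (Fin q) (Fin p) ℝ) (θ : Matrix (Fin p) (Fin p) ℝ)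
    (x : Matrix (Fin (q + p)) (Fin p) ℝ)

def wA (ω : Matrix (Fin (q + p)) (Fin (q + p)) ℤ) : Matrix (Fin (q + p)) (Fin q) ℤ :=
  Matrix.of fun i j => ω i (Fin.castAdd p j)

def wB (ω : Matrix (Fin (q + p)) (Fin (q + p)) ℤ) : Matrix (Fin (q + p)) (Fin p) ℤ :=
  Matrix.of fun i j => ω i (Fin.natAdd q j)

lemma mul_x (hxtop : ∀ i j, x (Fin.castAdd p i) j = (ξ * θ) i j)
    (hxbot : ∀ i j, x (Fin.natAdd q i) j = θ i j)
    (ω : Matrix (Fin (q + p)) (Fin (q + p)) ℤ) :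
    rc ω * x = (rc (wA ω) * ξ + rc (wB ω)) * θ := by
  rw [Matrix.add_mul, Matrix.mul_assoc]
  ext i j
  rw [Matrix.add_apply, Matrix.mul_apply, Fin.sum_univ_add, Matrix.mul_apply, Matrix.mul_apply]
  simp [hxtop, hxbot, rc, wA, wB]

lemma mem_HU (hp : 1 ≤ p) (hθ : θ.det ≠ 0)
    (hxtop : ∀ i j, x (Fin.castAdd p i) j = (ξ * θ) i j)
    (hxbot : ∀ i j, x (Fin.natAdd q i) j = θ i j) {a : ℝ} (ha0 : 0 ≤ a)
    (ha : (SA ξ a).Finite) : a ∈ HU x := by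
  obtain ⟨c, hc, hc1, hlow⟩ := lower_bound ξ ha
  set K : ℝ := p * ‖θ⁻¹‖ + 1 with hK
  have hKpos : 0 < K := by positivity
  refine ⟨c / (2 * K), by positivity, fun ω hω => ?_⟩
  change _ < ‖rc ω * x‖
  change c / (2 * K) * ‖rc ω‖ ^ (-a) < _
  rw [mul_x ξ θ x hxtop hxbot]
  set M := rc (wA ω) * ξ + rc (wB ω) with hM
  have hω1 := one_le_norm hω
  have hωp : 0 < ‖rc ω‖ ^ (-a) := Real.rpow_pos_of_pos (by linarith) _
  have hMK : ‖M‖ ≤ K * ‖M * θ‖ := by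
    have h1 : M * θ * θ⁻¹ = M := by
      rw [Matrix.mul_assoc, Matrix.mul_nonsing_inv _ (isUnit_iff_ne_zero.2 hθ), Matrix.mul_one]
    have h2 := norm_mul_le' (M * θ) θ⁻¹
    rw [h1] at h2
    nlinarith [norm_nonneg (M * θ)]
  have hkey : c * ‖rc ω‖ ^ (-a) ≤ ‖M‖ := by
    by_cases hA : wA ω = 0
    · have hB : wB ω ≠ 0 := by
        intro hB
        apply hω
        ext i j
        refine Fin.addCases (fun j => ?_) (fun j => ?_) j
        · exact congrFun (congrFun hA i) j
        · exact congrFun (congrFun hB i) j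
      have h1 : M = rc (wB ω) := by
        rw [hM, hA]; ext i j; simp [rc]
      rw [h1]
      have h2 : ‖rc ω‖ ^ (-a) ≤ 1 := Real.rpow_le_one_of_one_le_of_nonpos hω1 (by linarith)
      have := one_le_norm hB
      nlinarith
    · have : ∃ i j, wA ω i j ≠ 0 := by
        by_contra hcon; push Not at hcon; exact hA (by ext i j; exact hcon i j)
      obtain ⟨i, j, hij⟩ := this
      let α : Matrix (Fin p) (Fin q) ℤ := Matrix.of fun _ l => wA ω i l
      let β : Matrix (Fin p) (Fin p) ℤ := Matrix.of fun _ l => wB ω i l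
      have hα : α ≠ 0 := fun h => hij (congrFun (congrFun h ⟨0, hp⟩) j)
      have h1 : ‖rc α * ξ + rc β‖ ≤ ‖M‖ := by
        refine norm_le_of _ (norm_nonneg _) (fun k l => ?_)
        exact entry_le M i l
      have h2 : ‖rc α‖ ≤ ‖rc ω‖ :=
        norm_le_of _ (norm_nonneg _) (fun k l => entry_le (rc ω) i (Fin.castAdd p l))
      have h3 : ‖rc ω‖ ^ (-a) ≤ ‖rc α‖ ^ (-a) :=
        Real.rpow_le_rpow_of_nonpos (lt_of_lt_of_le one_pos (one_le_norm hα)) h2 (by linarith)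
      have h4 := hlow α hα
      have h5 := dval_le ξ α β
      nlinarith
  have : c / (2 * K) * ‖rc ω‖ ^ (-a) = (c * ‖rc ω‖ ^ (-a)) / (2 * K) := by ring
  rw [this, div_lt_iff₀ (by positivity)]
  have h0 : 0 < c * ‖rc ω‖ ^ (-a) := by positivity
  nlinarith

lemma le_of_mem (hp : 1 ≤ p)
    (hxtop : ∀ i j, x (Fin.castAdd p i) j = (ξ * θ) i j)
    (hxbot : ∀ i j, x (Fin.natAdd q i) j = θ i j) {a u : ℝ} (ha0 : 0 ≤ a)
    (ha : (SA ξ a).Infinite) (hu : u ∈ HU x) : a ≤ u := by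
  by_contra hlt
  push Not at hlt
  obtain ⟨c, hc, hω⟩ := hu
  set C : ℝ := 1 + q * ‖ξ‖ with hC
  have hC1 : 1 ≤ C := by rw [hC]; have : 0 ≤ q * ‖ξ‖ := by positivity
                         linarith
  set D : ℝ := C ^ (-|u|) with hD
  have hDpos : 0 < D := Real.rpow_pos_of_pos (by linarith) _
  set T : ℝ := (p * ‖θ‖ + 1) / (c * D) with hT
  have hTpos : 0 < T := by positivity
  apply ha
  refine (finite_le (T ^ (1 / (a - u)))).subset ?_
  rintro α ⟨hα, hd⟩
  change dval ξ α < ‖rc α‖ ^ (-a) at hd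
  change ‖rc α‖ ≤ _
  have hα1 := one_le_norm hα
  have hαpos : 0 < ‖rc α‖ := by linarith
  obtain ⟨β, hβ, hhalf⟩ := dval_attained ξ α
  have hβn : ‖rc β‖ ≤ C * ‖rc α‖ := by
    have e : rc β = (rc α * ξ + rc β) - rc α * ξ := by abel
    have h1 : ‖rc β‖ ≤ ‖rc α * ξ + rc β‖ + ‖rc α * ξ‖ := by
      conv_lhs => rw [e]
      exact norm_sub_le _ _
    have h2 := norm_mul_le' (rc α) ξ
    rw [← hβ] at h1
    rw [hC]
    nlinarith
  let f : Fin (q + p) → Fin p := fun i => ⟨i % p, Nat.mod_lt _ hp⟩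
  have hf : ∀ k : Fin p, ∃ i, f i = k := fun k =>
    ⟨⟨k, by omega⟩, by ext; simp [f, Nat.mod_eq_of_lt k.2]⟩
  let ω : Matrix (Fin (q + p)) (Fin (q + p)) ℤ :=
    Matrix.of fun i j => Fin.addCases (motive := fun _ => ℤ) (fun l => α (f i) l) (fun l => β (f i) l) j
  have hwA : ∀ i j, wA ω i j = α (f i) j := fun i j => by simp [wA, ω]
  have hwB : ∀ i j, wB ω i j = β (f i) j := fun i j => by simp [wB, ω]
  have hlow : ‖rc α‖ ≤ ‖rc ω‖ := by
    refine norm_le_of _ (norm_nonneg _) (fun k l => ?_)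
    obtain ⟨i, rfl⟩ := hf k
    have := entry_le (rc ω) i (Fin.castAdd p l)
    simpa [rc, ω] using this
  have hωne : ω ≠ 0 := by
    intro h0
    rw [h0] at hlow
    have : rc (0 : Matrix (Fin (q + p)) (Fin (q + p)) ℤ) = 0 := by ext i j; simp [rc]
    rw [this, norm_zero] at hlow
    linarith
  have hup : ‖rc ω‖ ≤ C * ‖rc α‖ := by
    refine norm_le_of _ (by positivity) (fun i j => ?_)
    refine Fin.addCases (fun l => ?_) (fun l => ?_) j
    · have := entry_le (rc α) (f i) l
      have h2 : |rc ω i (Fin.castAdd p l)| = |rc α (f i) l| := by simp [rc, ω]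
      rw [h2]; nlinarith
    · have := entry_le (rc β) (f i) l
      have h2 : |rc ω i (Fin.natAdd q l)| = |rc β (f i) l| := by simp [rc, ω]
      rw [h2]; linarith
  have hpow : D * ‖rc α‖ ^ (-u) ≤ ‖rc ω‖ ^ (-u) := by
    rcases le_total 0 u with h0 | h0
    · rw [hD, abs_of_nonneg h0, ← Real.mul_rpow (by linarith) hαpos.le]
      exact Real.rpow_le_rpow_of_nonpos (by linarith) hup (by linarith)
    · have h1 : ‖rc α‖ ^ (-u) ≤ ‖rc ω‖ ^ (-u) :=
        Real.rpow_le_rpow hαpos.le hlow (by linarith)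
      have h2 : D ≤ 1 := Real.rpow_le_one_of_one_le_of_nonpos hC1 (by simp)
      have h3 : 0 ≤ ‖rc α‖ ^ (-u) := by positivity
      nlinarith
  have h1 := hω ω hωne
  change c * ‖rc ω‖ ^ (-u) < ‖rc ω * x‖ at h1
  rw [mul_x ξ θ x hxtop hxbot] at h1
  have h2 := norm_mul_le' (rc (wA ω) * ξ + rc (wB ω)) θ
  have h3 : ‖rc (wA ω) * ξ + rc (wB ω)‖ ≤ dval ξ α := by
    rw [hβ]
    refine norm_le_of _ (norm_nonneg _) (fun i j => ?_)
    have := entry_le (rc α * ξ + rc β) (f i) j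
    simpa [Matrix.mul_apply, rc, hwA, hwB] using this
  have hap : 0 < ‖rc α‖ ^ (-a) := Real.rpow_pos_of_pos hαpos _
  have h4 : c * D * ‖rc α‖ ^ (-u) ≤ (p * ‖θ‖ + 1) * ‖rc α‖ ^ (-a) := by
    have h5 : ‖rc (wA ω) * ξ + rc (wB ω)‖ ≤ ‖rc α‖ ^ (-a) := h3.trans hd.le
    have h6 : (p : ℝ) * ‖rc (wA ω) * ξ + rc (wB ω)‖ * ‖θ‖ ≤ p * ‖rc α‖ ^ (-a) * ‖θ‖ := by
      gcongr
    have h7 : c * (D * ‖rc α‖ ^ (-u)) ≤ c * ‖rc ω‖ ^ (-u) := by gcongr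
    nlinarith
  have h8 : ‖rc α‖ ^ (a - u) ≤ T := by
    have e : ‖rc α‖ ^ (-u) = ‖rc α‖ ^ (a - u) * ‖rc α‖ ^ (-a) := by
      rw [← Real.rpow_add hαpos]; congr 1; ring
    rw [e, ← mul_assoc] at h4
    have h9 := le_of_mul_le_mul_right h4 hap
    rw [hT, le_div_iff₀ (by positivity)]
    linarith
  have hau : a - u ≠ 0 := by linarith
  calc ‖rc α‖ = (‖rc α‖ ^ (a - u)) ^ (1 / (a - u)) := by
        rw [← Real.rpow_mul hαpos.le, mul_one_div_cancel hau, Real.rpow_one]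
    _ ≤ _ := by
        apply Real.rpow_le_rpow (by positivity) h8
        have : 0 < a - u := by linarith
        positivity

lemma final (hp : 1 ≤ p) (hq : 1 ≤ q) (hθ : θ.det ≠ 0)
    (hxtop : ∀ i j, x (Fin.castAdd p i) j = (ξ * θ) i j)
    (hxbot : ∀ i j, x (Fin.natAdd q i) j = θ i j) : homExp x = dioExp ξ := by
  change sInf (HU x) = sSup {a | (SA ξ a).Infinite}
  have hmem : ∀ a, ¬ (SA ξ a).Infinite → a ∈ HU x := by
    intro a ha
    refine mem_HU ξ θ x hp hθ hxtop hxbot ?_ (Set.not_infinite.1 ha)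
    by_contra h
    exact ha (SA_nonpos hp hq ξ (not_le.1 h).le)
  have hle : ∀ a u, (SA ξ a).Infinite → u ∈ HU x → a ≤ u := by
    intro a u ha hu
    have h0 := le_of_mem ξ θ x hp hxtop hxbot le_rfl (SA_nonpos hp hq ξ le_rfl) hu
    rcases le_total 0 a with h | h
    · exact le_of_mem ξ θ x hp hxtop hxbot h ha hu
    · exact h.trans h0
  have h0 : (SA ξ 0).Infinite := SA_nonpos hp hq ξ le_rfl
  rcases (HU x).eq_empty_or_nonempty with he | ⟨u, hu⟩
  · have : {a | (SA ξ a).Infinite} = Set.univ := by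
      ext a
      simp only [Set.mem_setOf_eq, Set.mem_univ, iff_true]
      by_contra h
      have := hmem a h
      rw [he] at this
      exact this
    rw [this, he, Real.sInf_empty, Real.sSup_univ]
  · refine le_antisymm ?_ ?_
    · by_contra hlt
      obtain ⟨a, h1, h2⟩ := exists_between (not_le.1 hlt)
      have ha : ¬ (SA ξ a).Infinite := fun h =>
        absurd (le_csSup ⟨u, fun b hb => hle b u hb hu⟩ h) (not_le.2 h1)
      exact absurd (csInf_le ⟨0, fun v hv => hle 0 v h0 hv⟩ (hmem a ha)) (not_le.2 h2)
    · exact csSup_le ⟨0, h0⟩ (fun a ha => le_csInf ⟨u, hu⟩ (fun v hv => hle a v ha hv))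
end

end HomDio

/-- **Proposition 4.2.** If `x` is the `n×p` matrix formed by stacking `ξθ` on top of `θ`
(with `θ` invertible), then `h(x) = e(ξ)`. -/
theorem homExp_eq_dioExp
    (n p q : ℕ) (hn : 2 ≤ n) (hp : 1 ≤ p) (hpn : p ≤ n - 1) (hq : q = n - p)
    (ξ : Matrix (Fin q) (Fin p) ℝ) (θ : Matrix (Fin p) (Fin p) ℝ) (hθ : θ.det ≠ 0)
    (x : Matrix (Fin n) (Fin p) ℝ)
    (hxtop : ∀ (i : Fin q) (j : Fin p),
      x (Fin.cast (by omega) (Fin.castAdd p i)) j = (ξ * θ) i j)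
    (hxbot : ∀ (i : Fin p) (j : Fin p),
      x (Fin.cast (by omega) (Fin.natAdd q i)) j = θ i j) :
    homExp x = dioExp ξ := by
  obtain rfl : n = q + p := by omega
  exact HomDio.final ξ θ x hp (by omega) hθ hxtop hxbot
end

section
/- Let n ≥ 2, 1 ≤ p ≤ n−1 and q = n−p. Let ξ be a real q×p matrix, θ an invertible real p×p matrix, and let x ∈ ℝ^{(n,p)} be the n×p matrix formed by stacking ξθ on top of θ. Then x is projectively very well approximable (i.e., h(x) > (n−p)/p) if and only if ξ is very well approximable (i.e., e(ξ) > q/p). -/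
open Matrix

attribute [local instance] Matrix.normedAddCommGroup

section helpers

variable {p q : ℕ}

lemma aux_norm_mul {l m k : ℕ} (A : Matrix (Fin l) (Fin m) ℝ) (B : Matrix (Fin m) (Fin k) ℝ) :
    ‖A * B‖ ≤ m * ‖A‖ * ‖B‖ := by
  rw [Matrix.norm_le_iff (by positivity)]
  intro i j
  rw [Matrix.mul_apply]
  calc ‖∑ t, A i t * B t j‖ ≤ ∑ t, ‖A i t * B t j‖ := norm_sum_le _ _
    _ ≤ ∑ _t : Fin m, ‖A‖ * ‖B‖ := by
        apply Finset.sum_le_sum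
        intro t _
        rw [norm_mul]
        exact mul_le_mul (Matrix.norm_entry_le_entrywise_sup_norm A)
          (Matrix.norm_entry_le_entrywise_sup_norm B) (norm_nonneg _) (norm_nonneg _)
    _ = m * ‖A‖ * ‖B‖ := by simp [mul_assoc]

lemma aux_one_le {l m : ℕ} (A : Matrix (Fin l) (Fin m) ℤ) (h : A ≠ 0) :
    1 ≤ ‖A.map (Int.cast : ℤ → ℝ)‖ := by
  have : ∃ i j, A i j ≠ 0 := by
    by_contra! hc
    exact h (by ext i j; exact hc i j)
  obtain ⟨i, j, hij⟩ := this
  refine le_trans ?_ (Matrix.norm_entry_le_entrywise_sup_norm (A.map (Int.cast : ℤ → ℝ)) (i := i) (j := j))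
  rw [Matrix.map_apply, Real.norm_eq_abs]
  exact_mod_cast Int.one_le_abs hij

lemma aux_finite {l m : ℕ} (R : ℝ) :
    {A : Matrix (Fin l) (Fin m) ℤ | ‖A.map (Int.cast : ℤ → ℝ)‖ ≤ R}.Finite := by
  have hf : (Set.Icc (fun _ _ => -⌈R⌉ : Fin l → Fin m → ℤ) (fun _ _ => ⌈R⌉)).Finite :=
    Set.finite_Icc _ _
  refine Set.Finite.subset hf ?_
  intro (A : Matrix (Fin l) (Fin m) ℤ) (hA : ‖A.map (Int.cast : ℤ → ℝ)‖ ≤ R)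
  have key : ∀ i j, |A i j| ≤ ⌈R⌉ := by
    intro i j
    have h1 := (Matrix.norm_entry_le_entrywise_sup_norm (A.map (Int.cast : ℤ → ℝ)) (i := i) (j := j)).trans hA
    rw [Matrix.map_apply, Real.norm_eq_abs] at h1
    have h2 := h1.trans (Int.le_ceil R)
    exact_mod_cast h2
  exact ⟨fun i j => (abs_le.1 (key i j)).1, fun i j => (abs_le.1 (key i j)).2⟩

lemma aux_dval_le (ξ : Matrix (Fin q) (Fin p) ℝ) (α : Matrix (Fin p) (Fin q) ℤ)
    (β : Matrix (Fin p) (Fin p) ℤ) :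
    dval ξ α ≤ ‖(α.map (Int.cast : ℤ → ℝ)) * ξ + β.map (Int.cast : ℤ → ℝ)‖ := by
  apply csInf_le
  · refine ⟨0, ?_⟩
    rintro r ⟨β, rfl⟩
    exact norm_nonneg _
  · exact ⟨β, rfl⟩

lemma aux_dval_nonneg (ξ : Matrix (Fin q) (Fin p) ℝ) (α : Matrix (Fin p) (Fin q) ℤ) :
    0 ≤ dval ξ α := by
  apply Real.sInf_nonneg
  rintro r ⟨β, rfl⟩
  exact norm_nonneg _

lemma aux_dval_lt (ξ : Matrix (Fin q) (Fin p) ℝ) (α : Matrix (Fin p) (Fin q) ℤ) (r : ℝ)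
    (h : dval ξ α < r) : ∃ β : Matrix (Fin p) (Fin p) ℤ,
      ‖(α.map (Int.cast : ℤ → ℝ)) * ξ + β.map (Int.cast : ℤ → ℝ)‖ < r := by
  unfold dval at h
  obtain ⟨s, ⟨β, rfl⟩, hs⟩ := exists_lt_of_csInf_lt
    (by exact ⟨_, (0 : Matrix (Fin p) (Fin p) ℤ), rfl⟩) h
  exact ⟨β, hs⟩

lemma aux_map_smul {l k : ℕ} (m : ℤ) (α : Matrix (Fin l) (Fin k) ℤ) :
    (m • α).map (Int.cast : ℤ → ℝ) = (m : ℝ) • α.map (Int.cast : ℤ → ℝ) := by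
  ext i j; simp

lemma aux_dval_smul (ξ : Matrix (Fin q) (Fin p) ℝ) (α : Matrix (Fin p) (Fin q) ℤ)
    (h : dval ξ α = 0) (m : ℤ) (hm : 0 < m) : dval ξ (m • α) = 0 := by
  refine le_antisymm ?_ (aux_dval_nonneg _ _)
  apply le_of_forall_pos_lt_add
  intro ε hε
  have hm' : (0 : ℝ) < m := by exact_mod_cast hm
  obtain ⟨β, hβ⟩ := aux_dval_lt ξ α (ε / m) (by rw [h]; positivity)
  have h1 := aux_dval_le ξ (m • α) (m • β)
  have : NormSMulClass ℝ (Matrix (Fin p) (Fin p) ℝ) := Matrix.normSMulClass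
  rw [aux_map_smul, aux_map_smul, Matrix.smul_mul, ← smul_add, norm_smul, Real.norm_eq_abs,
    abs_of_pos hm'] at h1
  rw [lt_div_iff₀ hm'] at hβ
  linarith

/-- the approximating set -/
def auxA (ξ : Matrix (Fin q) (Fin p) ℝ) : Set ℝ := {a : ℝ | {α : Matrix (Fin p) (Fin q) ℤ | α ≠ 0 ∧
    dval ξ α < ‖α.map (Int.cast : ℤ → ℝ)‖ ^ (-a)}.Infinite}

/-- the homogeneous set -/
def auxU {n : ℕ} (x : Matrix (Fin n) (Fin p) ℝ) : Set ℝ :=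
  {u : ℝ | ∃ c > (0 : ℝ), ∀ ω : Matrix (Fin n) (Fin n) ℤ, ω ≠ 0 →
    c * ‖ω.map (Int.cast : ℤ → ℝ)‖ ^ (-u) < ‖(ω.map (Int.cast : ℤ → ℝ)) * x‖}

lemma aux_U_up {n : ℕ} (x : Matrix (Fin n) (Fin p) ℝ) {u v : ℝ} (hu : u ∈ auxU x) (huv : u ≤ v) :
    v ∈ auxU x := by
  obtain ⟨c, hc, h⟩ := hu
  refine ⟨c, hc, fun ω hω => lt_of_le_of_lt ?_ (h ω hω)⟩
  apply mul_le_mul_of_nonneg_left _ hc.le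
  exact Real.rpow_le_rpow_of_exponent_le (aux_one_le ω hω) (by linarith)

lemma aux_delta (ξ : Matrix (Fin q) (Fin p) ℝ) {u : ℝ} (hu : u ∉ auxA ξ) :
    ∃ δ > 0, δ ≤ 1 ∧ ∀ α : Matrix (Fin p) (Fin q) ℤ, α ≠ 0 →
      δ * ‖α.map (Int.cast : ℤ → ℝ)‖ ^ (-u) ≤ dval ξ α := by
  have hfin : {α : Matrix (Fin p) (Fin q) ℤ | α ≠ 0 ∧
    dval ξ α < ‖α.map (Int.cast : ℤ → ℝ)‖ ^ (-u)}.Finite := by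
    by_contra hc
    exact hu hc
  have hpos : ∀ α : Matrix (Fin p) (Fin q) ℤ, α ≠ 0 → 0 < dval ξ α := by
    intro α hα
    refine lt_of_le_of_ne (aux_dval_nonneg _ _) (fun h0 => ?_)
    have hinj : Function.Injective (fun m : ℕ => ((m : ℤ) + 1) • α) := by
      intro a b hab
      have := smul_left_injective ℤ hα hab
      simpa using this
    refine (Set.infinite_range_of_injective hinj) (hfin.subset ?_)
    rintro _ ⟨m, rfl⟩
    have hne : ((m : ℤ) + 1) • α ≠ 0 := smul_ne_zero (by omega) hα
    refine ⟨hne, ?_⟩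
    show dval ξ (((m : ℤ) + 1) • α) < _
    rw [aux_dval_smul ξ α h0.symm _ (by omega)]
    exact Real.rpow_pos_of_pos (lt_of_lt_of_le one_pos (aux_one_le _ hne)) _
  let f : Matrix (Fin p) (Fin q) ℤ → ℝ :=
    fun α => dval ξ α / ‖α.map (Int.cast : ℤ → ℝ)‖ ^ (-u)
  have hbd : ∃ δ > 0, δ ≤ 1 ∧ ∀ α ∈ {α : Matrix (Fin p) (Fin q) ℤ | α ≠ 0 ∧
    dval ξ α < ‖α.map (Int.cast : ℤ → ℝ)‖ ^ (-u)}, δ ≤ f α := by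
    rcases Set.eq_empty_or_nonempty {α : Matrix (Fin p) (Fin q) ℤ | α ≠ 0 ∧
      dval ξ α < ‖α.map (Int.cast : ℤ → ℝ)‖ ^ (-u)} with he | hne
    · exact ⟨1, one_pos, le_rfl, by rw [he]; simp⟩
    · obtain ⟨a, ha, hmin⟩ := Set.exists_min_image _ f hfin hne
      refine ⟨min 1 (f a), lt_min one_pos ?_, min_le_left _ _, fun b hb =>
        (min_le_right _ _).trans (hmin b hb)⟩
      exact div_pos (hpos a ha.1)
        (Real.rpow_pos_of_pos (lt_of_lt_of_le one_pos (aux_one_le _ ha.1)) _)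
  obtain ⟨δ, hδ, hδ1, h⟩ := hbd
  refine ⟨δ, hδ, hδ1, fun α hα => ?_⟩
  have hp := Real.rpow_pos_of_pos (lt_of_lt_of_le one_pos (aux_one_le _ hα)) (-u)
  by_cases hlt : dval ξ α < ‖α.map (Int.cast : ℤ → ℝ)‖ ^ (-u)
  · have := h α ⟨hα, hlt⟩
    exact (le_div_iff₀ hp).1 this
  · push Not at hlt
    nlinarith

lemma aux_F1 (hp : 1 ≤ p) (ξ : Matrix (Fin q) (Fin p) ℝ) (θ : Matrix (Fin p) (Fin p) ℝ) (hθ : θ.det ≠ 0)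
    (x : Matrix (Fin (q + p)) (Fin p) ℝ)
    (hxtop : ∀ (i : Fin q) (j : Fin p), x (Fin.castAdd p i) j = (ξ * θ) i j)
    (hxbot : ∀ (i : Fin p) (j : Fin p), x (Fin.natAdd q i) j = θ i j) {u : ℝ} (hu0 : 0 < u)
    (hu : u ∉ auxA ξ) : u ∈ auxU x := by
  obtain ⟨δ, hδ, hδ1, hd⟩ := aux_delta ξ hu
  set C : ℝ := p * ‖θ⁻¹‖ + 1 with hC
  have hCpos : 0 < C := by positivity
  refine ⟨δ / C / 2, by positivity, fun ω hω => ?_⟩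
  have : ∃ i j, ω i j ≠ 0 := by
    by_contra! hc
    exact hω (by ext i j; exact hc i j)
  obtain ⟨i, j0, hij⟩ := this
  let α : Matrix (Fin p) (Fin q) ℤ := Matrix.of fun _ j => ω i (Fin.castAdd p j)
  let β : Matrix (Fin p) (Fin p) ℤ := Matrix.of fun _ j => ω i (Fin.natAdd q j)
  let M : Matrix (Fin p) (Fin p) ℝ := Matrix.of fun _ j => (ω.map (Int.cast : ℤ → ℝ) * x) i j
  have hω1 := aux_one_le ω hω
  have hMle : ‖M‖ ≤ ‖ω.map (Int.cast : ℤ → ℝ) * x‖ := by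
    rw [Matrix.norm_le_iff (norm_nonneg _)]
    intro a b
    exact Matrix.norm_entry_le_entrywise_sup_norm (ω.map (Int.cast : ℤ → ℝ) * x) (i := i) (j := b)
  have hMeq : (α.map (Int.cast : ℤ → ℝ) * ξ + β.map (Int.cast : ℤ → ℝ)) * θ = M := by
    rw [Matrix.add_mul, Matrix.mul_assoc]
    ext a b
    simp only [M, α, β, Matrix.add_apply, Matrix.mul_apply (M := Matrix.map _ _), Matrix.map_apply,
      Matrix.of_apply, Fin.sum_univ_add, hxtop, hxbot]
  have hinv : α.map (Int.cast : ℤ → ℝ) * ξ + β.map (Int.cast : ℤ → ℝ) = M * θ⁻¹ := by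
    rw [← hMeq, Matrix.mul_assoc, Matrix.mul_nonsing_inv _ (isUnit_iff_ne_zero.2 hθ), Matrix.mul_one]
  have hle : ‖α.map (Int.cast : ℤ → ℝ) * ξ + β.map (Int.cast : ℤ → ℝ)‖ ≤
      C * ‖ω.map (Int.cast : ℤ → ℝ) * x‖ := by
    rw [hinv]
    refine (aux_norm_mul _ _).trans ?_
    have h1 : (p : ℝ) * ‖θ⁻¹‖ * ‖M‖ ≤ C * ‖M‖ :=
      mul_le_mul_of_nonneg_right (by rw [hC]; linarith) (norm_nonneg _)
    have h2 := mul_le_mul_of_nonneg_left hMle hCpos.le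
    linarith
  have hmain : δ * ‖ω.map (Int.cast : ℤ → ℝ)‖ ^ (-u) ≤
      ‖α.map (Int.cast : ℤ → ℝ) * ξ + β.map (Int.cast : ℤ → ℝ)‖ := by
    by_cases hα : α = 0
    · have hβ : β ≠ 0 := by
        intro hβ
        apply hij
        refine Fin.addCases (motive := fun j => ω i j = 0) (fun j => ?_) (fun j => ?_) j0
        · exact congrFun (congrFun hα ⟨0, hp⟩) j
        · exact congrFun (congrFun hβ ⟨0, hp⟩) j
      have h1 := aux_one_le β hβ
      have h2 : α.map (Int.cast : ℤ → ℝ) = 0 := by rw [hα]; ext; simp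
      rw [h2, Matrix.zero_mul, zero_add]
      have h3 : ‖ω.map (Int.cast : ℤ → ℝ)‖ ^ (-u) ≤ 1 :=
        Real.rpow_le_one_of_one_le_of_nonpos hω1 (by linarith)
      nlinarith
    · refine le_trans ?_ ((hd α hα).trans (aux_dval_le ξ α β))
      apply mul_le_mul_of_nonneg_left _ hδ.le
      apply Real.rpow_le_rpow_of_nonpos (lt_of_lt_of_le one_pos (aux_one_le _ hα)) _ (by linarith)
      rw [Matrix.norm_le_iff (norm_nonneg _)]
      intro a b
      exact Matrix.norm_entry_le_entrywise_sup_norm (ω.map (Int.cast : ℤ → ℝ)) (i := i) (j := Fin.castAdd p b)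
  have hpos : 0 < δ * ‖ω.map (Int.cast : ℤ → ℝ)‖ ^ (-u) :=
    mul_pos hδ (Real.rpow_pos_of_pos (by linarith) _)
  have hfin := hmain.trans hle
  have : δ / C / 2 * ‖ω.map (Int.cast : ℤ → ℝ)‖ ^ (-u) =
    (δ * ‖ω.map (Int.cast : ℤ → ℝ)‖ ^ (-u)) / (2 * C) := by field_simp
  rw [this, div_lt_iff₀ (by positivity)]
  linarith

lemma aux_F2 (ξ : Matrix (Fin q) (Fin p) ℝ) (θ : Matrix (Fin p) (Fin p) ℝ)
    (x : Matrix (Fin (q + p)) (Fin p) ℝ)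
    (hxtop : ∀ (i : Fin q) (j : Fin p), x (Fin.castAdd p i) j = (ξ * θ) i j)
    (hxbot : ∀ (i : Fin p) (j : Fin p), x (Fin.natAdd q i) j = θ i j) {u a : ℝ} (hu0 : 0 ≤ u)
    (hu : u ∈ auxU x) (hua : u < a) : a ∉ auxA ξ := by
  obtain ⟨c, hc, hU⟩ := hu
  intro hA
  apply hA
  set K : ℝ := 1 + q * ‖ξ‖ with hK
  have hK1 : 1 ≤ K := by rw [hK]; linarith [show (0 : ℝ) ≤ q * ‖ξ‖ by positivity]
  set D : ℝ := p * ‖θ‖ / (c * K ^ (-u)) with hD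
  have hKp : 0 < K ^ (-u) := Real.rpow_pos_of_pos (by linarith) _
  have hD0 : 0 ≤ D := by positivity
  refine (aux_finite (D ^ (a - u)⁻¹)).subset ?_
  rintro α ⟨hα, hlt⟩
  obtain ⟨β, hβ⟩ := aux_dval_lt ξ α _ hlt
  have hα1 := aux_one_le α hα
  have hα0 : 0 < ‖α.map (Int.cast : ℤ → ℝ)‖ := by linarith
  have : ∃ i j, α i j ≠ 0 := by
    by_contra! hc
    exact hα (by ext i j; exact hc i j)
  obtain ⟨i, j0, hij⟩ := this
  let ω : Matrix (Fin (q + p)) (Fin (q + p)) ℤ := Matrix.of fun _ j => Fin.append (α i) (β i) j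
  have hω : ω ≠ 0 := by
    intro h
    apply hij
    have := congrFun (congrFun h (Fin.castAdd p j0)) (Fin.castAdd p j0)
    simpa [ω] using this
  have hω1 := aux_one_le ω hω
  have hβK : ‖β.map (Int.cast : ℤ → ℝ)‖ ≤ K * ‖α.map (Int.cast : ℤ → ℝ)‖ := by
    have h1 : β.map (Int.cast : ℤ → ℝ) = (α.map (Int.cast : ℤ → ℝ) * ξ + β.map (Int.cast : ℤ → ℝ)) -
      α.map (Int.cast : ℤ → ℝ) * ξ := by abel
    have h2 := norm_sub_le (α.map (Int.cast : ℤ → ℝ) * ξ + β.map (Int.cast : ℤ → ℝ))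
      (α.map (Int.cast : ℤ → ℝ) * ξ)
    rw [← h1] at h2
    have h3 := aux_norm_mul (α.map (Int.cast : ℤ → ℝ)) ξ
    have h4 : ‖α.map (Int.cast : ℤ → ℝ)‖ ^ (-a) ≤ 1 :=
      Real.rpow_le_one_of_one_le_of_nonpos hα1 (by linarith)
    rw [hK]
    linarith
  have hωK : ‖ω.map (Int.cast : ℤ → ℝ)‖ ≤ K * ‖α.map (Int.cast : ℤ → ℝ)‖ := by
    rw [Matrix.norm_le_iff (by positivity)]
    intro b j
    refine Fin.addCases (fun j => ?_) (fun j => ?_) j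
    · simp only [ω, Matrix.map_apply, Matrix.of_apply, Fin.append_left]
      refine le_trans (Matrix.norm_entry_le_entrywise_sup_norm (α.map (Int.cast : ℤ → ℝ)) (i := i) (j := j)) ?_
      nlinarith
    · simp only [ω, Matrix.map_apply, Matrix.of_apply, Fin.append_right]
      exact le_trans (Matrix.norm_entry_le_entrywise_sup_norm (β.map (Int.cast : ℤ → ℝ)) (i := i) (j := j)) hβK
  have hωx : ‖ω.map (Int.cast : ℤ → ℝ) * x‖ ≤ p * ‖θ‖ * ‖α.map (Int.cast : ℤ → ℝ)‖ ^ (-a) := by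
    have h1 : ‖ω.map (Int.cast : ℤ → ℝ) * x‖ ≤
        ‖(α.map (Int.cast : ℤ → ℝ) * ξ + β.map (Int.cast : ℤ → ℝ)) * θ‖ := by
      rw [Matrix.norm_le_iff (norm_nonneg _)]
      intro b j
      refine le_trans (le_of_eq ?_) (Matrix.norm_entry_le_entrywise_sup_norm
        ((α.map (Int.cast : ℤ → ℝ) * ξ + β.map (Int.cast : ℤ → ℝ)) * θ) (i := i) (j := j))
      rw [Matrix.add_mul, Matrix.mul_assoc]
      simp only [ω, Matrix.add_apply, Matrix.mul_apply (M := Matrix.map _ _), Matrix.map_apply,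
        Matrix.of_apply, Fin.sum_univ_add, hxtop, hxbot, Fin.append_left, Fin.append_right]
    have h2 := aux_norm_mul (α.map (Int.cast : ℤ → ℝ) * ξ + β.map (Int.cast : ℤ → ℝ)) θ
    have h3 := mul_le_mul_of_nonneg_left hβ.le (show (0 : ℝ) ≤ p * ‖θ‖ by positivity)
    linarith
  have h5 := hU ω hω
  have h6 : (K * ‖α.map (Int.cast : ℤ → ℝ)‖) ^ (-u) ≤ ‖ω.map (Int.cast : ℤ → ℝ)‖ ^ (-u) :=
    Real.rpow_le_rpow_of_nonpos (by linarith) hωK (by linarith)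
  rw [Real.mul_rpow (by linarith) hα0.le] at h6
  have h7 := mul_le_mul_of_nonneg_left h6 hc.le
  have h8 : c * K ^ (-u) * ‖α.map (Int.cast : ℤ → ℝ)‖ ^ (-u) ≤
    p * ‖θ‖ * ‖α.map (Int.cast : ℤ → ℝ)‖ ^ (-a) := by linarith
  have h9 : ‖α.map (Int.cast : ℤ → ℝ)‖ ^ (-u) =
      ‖α.map (Int.cast : ℤ → ℝ)‖ ^ (a - u) * ‖α.map (Int.cast : ℤ → ℝ)‖ ^ (-a) := by
    rw [← Real.rpow_add hα0]; congr 1; ring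
  rw [h9, ← mul_assoc] at h8
  have h10 := le_of_mul_le_mul_right h8 (Real.rpow_pos_of_pos hα0 _)
  have h11 : ‖α.map (Int.cast : ℤ → ℝ)‖ ^ (a - u) ≤ D := by
    rw [hD, le_div_iff₀ (by positivity)]; linarith
  have h12 := Real.rpow_le_rpow (Real.rpow_nonneg hα0.le _) h11
    (show 0 ≤ (a - u)⁻¹ from inv_nonneg.2 (by linarith))
  rw [← Real.rpow_mul hα0.le, mul_inv_cancel₀ (by linarith), Real.rpow_one] at h12
  exact h12

end helpers

/-- **Proposition 4.2 (second part).** If `x` is the `n×p` matrix formed by stacking `ξθ`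
on top of `θ` (with `θ` invertible), then `x` is projectively very well approximable
(`h(x) > (n−p)/p`) if and only if `ξ` is very well approximable (`e(ξ) > q/p`). -/
theorem projectivelyVWA_iff_VWA
    (n p q : ℕ) (hn : 2 ≤ n) (hp : 1 ≤ p) (hpn : p ≤ n - 1) (hq : q = n - p)
    (ξ : Matrix (Fin q) (Fin p) ℝ) (θ : Matrix (Fin p) (Fin p) ℝ) (hθ : θ.det ≠ 0)
    (x : Matrix (Fin n) (Fin p) ℝ)
    (hxtop : ∀ (i : Fin q) (j : Fin p),
      x (Fin.cast (by omega) (Fin.castAdd p i)) j = (ξ * θ) i j)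
    (hxbot : ∀ (i : Fin p) (j : Fin p),
      x (Fin.cast (by omega) (Fin.natAdd q i)) j = θ i j) :
    ((n : ℝ) - p) / p < homExp x ↔ (q : ℝ) / p < dioExp ξ := by
  obtain rfl : n = q + p := by omega
  have hxt : ∀ (i : Fin q) (j : Fin p), x (Fin.castAdd p i) j = (ξ * θ) i j := hxtop
  have hxb : ∀ (i : Fin p) (j : Fin p), x (Fin.natAdd q i) j = θ i j := hxbot
  have hcast : (((q + p : ℕ) : ℝ) - p) / p = (q : ℝ) / p := by push_cast; ring
  rw [hcast]
  have ht : (0 : ℝ) ≤ (q : ℝ) / p := by positivity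
  have hh : homExp x = sInf (auxU x) := rfl
  have he : dioExp ξ = sSup (auxA ξ) := rfl
  rw [hh, he]
  generalize (q : ℝ) / p = t at ht
  have F1 : ∀ u : ℝ, 0 < u → u ∉ auxA ξ → u ∈ auxU x := fun u h0 h =>
    aux_F1 hp ξ θ hθ x hxt hxb h0 h
  have F2 : ∀ u ∈ auxU x, 0 ≤ u → ∀ a, u < a → a ∉ auxA ξ := fun u h h0 a ha =>
    aux_F2 ξ θ x hxt hxb h0 h ha
  constructor
  · intro h
    have hne : (auxU x).Nonempty := by
      by_contra hc
      rw [Set.not_nonempty_iff_eq_empty] at hc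
      rw [hc, Real.sInf_empty] at h
      linarith
    have hbd : BddBelow (auxU x) := by
      by_contra hc
      rw [Real.sInf_of_not_bddBelow hc] at h
      linarith
    obtain ⟨v, hv1, hv2⟩ := exists_between h
    have hvA : v ∈ auxA ξ := by
      by_contra hc
      exact absurd (csInf_le hbd (F1 v (by linarith) hc)) (by linarith)
    obtain ⟨u, hu⟩ := hne
    have hu0 : 0 ≤ u := by linarith [csInf_le hbd hu]
    have hbA : BddAbove (auxA ξ) := by
      refine ⟨u, fun a ha => ?_⟩
      by_contra hc
      exact F2 u hu hu0 a (not_le.1 hc) ha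
    exact lt_of_lt_of_le hv1 (le_csSup hbA hvA)
  · intro h
    have hne : (auxA ξ).Nonempty := by
      by_contra hc
      rw [Set.not_nonempty_iff_eq_empty] at hc
      rw [hc, Real.sSup_empty] at h
      linarith
    have hbd : BddAbove (auxA ξ) := by
      by_contra hc
      rw [Real.sSup_of_not_bddAbove hc] at h
      linarith
    obtain ⟨a, haA, hta⟩ := exists_lt_of_lt_csSup hne h
    have hUne : (auxU x).Nonempty := by
      refine ⟨sSup (auxA ξ) + 1, F1 _ (by linarith) (fun hc => ?_)⟩
      linarith [le_csSup hbd hc]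
    refine lt_of_lt_of_le hta (le_csInf hUne (fun u hu => ?_))
    by_contra hc
    push Not at hc
    rcases le_total 0 u with h0 | h0
    · exact F2 u hu h0 a hc haA
    · exact F2 0 (aux_U_up x hu h0) le_rfl a (by linarith) haA
end

section
/- Let n ≥ 2, 1 ≤ p ≤ n−1 and q = n−p. Let ξ be a real q×p matrix, θ an invertible real p×p matrix, and let x ∈ ℝ^{(n,p)} be the n×p matrix formed by stacking ξθ on top of θ. Then x is projectively badly approximable if and only if ξ is badly approximable, i.e., inf over nonzero p×q integer matrices α of d(α)·||α||^{(n−p)/p} > 0. -/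
open Matrix

attribute [local instance] Matrix.normedAddCommGroup

lemma nmul_aux {a b c : ℕ} (A : Matrix (Fin a) (Fin b) ℝ) (B : Matrix (Fin b) (Fin c) ℝ) :
    ‖A * B‖ ≤ (b * ‖B‖) * ‖A‖ := by
  rw [Matrix.norm_le_iff (by positivity)]
  intro i j
  rw [Matrix.mul_apply]
  refine (norm_sum_le _ _).trans ?_
  calc ∑ k, ‖A i k * B k j‖ ≤ ∑ k : Fin b, ‖A‖ * ‖B‖ := by
        refine Finset.sum_le_sum fun k _ => ?_
        rw [norm_mul]
        exact mul_le_mul (Matrix.norm_entry_le_entrywise_sup_norm A)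
          (Matrix.norm_entry_le_entrywise_sup_norm B) (norm_nonneg _) (norm_nonneg _)
    _ = _ := by simp; ring

lemma one_le_aux {a b : ℕ} (A : Matrix (Fin a) (Fin b) ℤ) (hA : A ≠ 0) :
    1 ≤ ‖A.map (Int.cast : ℤ → ℝ)‖ := by
  have : ∃ i j, A i j ≠ 0 := by
    by_contra! h
    exact hA (by ext i j; simpa using h i j)
  obtain ⟨i, j, h⟩ := this
  refine le_trans ?_ (Matrix.norm_entry_le_entrywise_sup_norm (A.map (Int.cast : ℤ → ℝ)) (i := i) (j := j))
  simp only [Matrix.map_apply, Real.norm_eq_abs]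
  exact_mod_cast Int.one_le_abs h

lemma split_aux {r p q : ℕ} (W : Matrix (Fin r) (Fin (q + p)) ℤ)
    (ξ : Matrix (Fin q) (Fin p) ℝ) (θ : Matrix (Fin p) (Fin p) ℝ)
    (x : Matrix (Fin (q + p)) (Fin p) ℝ)
    (h1 : ∀ i j, x (Fin.castAdd p i) j = (ξ * θ) i j)
    (h2 : ∀ i j, x (Fin.natAdd q i) j = θ i j) :
    W.map (Int.cast : ℤ → ℝ) * x =
      ((W.submatrix id (Fin.castAdd p)).map (Int.cast : ℤ → ℝ) * ξ
        + (W.submatrix id (Fin.natAdd q)).map (Int.cast : ℤ → ℝ)) * θ := by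
  rw [Matrix.add_mul, Matrix.mul_assoc]
  ext i j
  simp only [Matrix.add_apply]
  rw [Matrix.mul_apply, Fin.sum_univ_add, Matrix.mul_apply, Matrix.mul_apply]
  simp [h1, h2]

lemma dval_le_aux {p q : ℕ} (ξ : Matrix (Fin q) (Fin p) ℝ)
    (α : Matrix (Fin p) (Fin q) ℤ) (β : Matrix (Fin p) (Fin p) ℤ) :
    dval ξ α ≤ ‖(α.map (Int.cast : ℤ → ℝ)) * ξ + β.map (Int.cast : ℤ → ℝ)‖ :=
  csInf_le ⟨0, by rintro _ ⟨β, rfl⟩; exact norm_nonneg _⟩ ⟨β, rfl⟩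

lemma le_dval_aux {p q : ℕ} (ξ : Matrix (Fin q) (Fin p) ℝ)
    (α : Matrix (Fin p) (Fin q) ℤ) (m : ℝ)
    (h : ∀ β : Matrix (Fin p) (Fin p) ℤ,
      m ≤ ‖(α.map (Int.cast : ℤ → ℝ)) * ξ + β.map (Int.cast : ℤ → ℝ)‖) :
    m ≤ dval ξ α :=
  le_csInf ⟨_, 0, rfl⟩ (by rintro _ ⟨β, rfl⟩; exact h β)

lemma fwd_aux (p q : ℕ) (hp : 1 ≤ p) (hq : 1 ≤ q)
    (ξ : Matrix (Fin q) (Fin p) ℝ) (θ : Matrix (Fin p) (Fin p) ℝ)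
    (x : Matrix (Fin (q + p)) (Fin p) ℝ)
    (h1 : ∀ i j, x (Fin.castAdd p i) j = (ξ * θ) i j)
    (h2 : ∀ i j, x (Fin.natAdd q i) j = θ i j)
    (c : ℝ) (hc : 0 < c)
    (H : ∀ ω : Matrix (Fin (q + p)) (Fin (q + p)) ℤ, ω ≠ 0 →
        c < ‖(ω.map (Int.cast : ℤ → ℝ)) * x‖ ^ p * ‖ω.map (Int.cast : ℤ → ℝ)‖ ^ q) :
    ∃ c > (0 : ℝ), ∀ α : Matrix (Fin p) (Fin q) ℤ, α ≠ 0 →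
        c < dval ξ α * ‖α.map (Int.cast : ℤ → ℝ)‖ ^ ((q : ℝ) / p) := by
  set K : ℝ := p * ‖θ‖ + 1 with hK
  set L : ℝ := 1 + q * ‖ξ‖ with hL
  have hK0 : 0 < K := by positivity
  have hL1 : 1 ≤ L := by
    have : 0 ≤ q * ‖ξ‖ := by positivity
    linarith
  have hL0 : 0 < L := by linarith
  set e : ℝ := c / (K ^ p * L ^ q) with he
  have he0 : 0 < e := by positivity
  set m : ℝ := min (e ^ ((1:ℝ) / p)) 1 with hm
  have hm0 : 0 < m := by positivity
  have hmp : m ^ p ≤ e := by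
    calc m ^ p ≤ (e ^ ((1:ℝ) / p)) ^ p := by gcongr; exact min_le_left _ _
      _ = e := by
        rw [← Real.rpow_natCast, ← Real.rpow_mul he0.le, one_div_mul_cancel (by positivity),
          Real.rpow_one]
  refine ⟨m / 2, by positivity, fun α hα => ?_⟩
  have hα1 := one_le_aux α hα
  set a := ‖α.map (Int.cast : ℤ → ℝ)‖ with ha
  set t := a ^ ((q : ℝ) / p) with ht
  have ht1 : 1 ≤ t := Real.one_le_rpow hα1 (by positivity)
  have ht0 : 0 < t := by linarith
  have htp : t ^ p = a ^ q := by
    rw [ht, ← Real.rpow_natCast, ← Real.rpow_mul (by linarith), div_mul_cancel₀ _ (by positivity),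
      Real.rpow_natCast]
  have key : m / t ≤ dval ξ α := by
    apply le_dval_aux
    intro β
    set D := ‖(α.map (Int.cast : ℤ → ℝ)) * ξ + β.map (Int.cast : ℤ → ℝ)‖ with hD
    have hD0 : 0 ≤ D := norm_nonneg _
    rw [div_le_iff₀ ht0]
    rcases le_total 1 D with h | h
    · calc m ≤ 1 := min_le_right _ _
        _ ≤ D * t := by nlinarith
    · let ω : Matrix (Fin (q + p)) (Fin (q + p)) ℤ :=
        fun i => Fin.addCases (fun _ => 0) (fun i' => Fin.addCases (α i') (β i')) i
      have ew0 : ∀ (i : Fin q) k, ω (Fin.castAdd p i) k = 0 := by intro i k; simp [ω]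
      have ew1 : ∀ (i : Fin p) k, ω (Fin.natAdd q i) (Fin.castAdd p k) = α i k := by
        intro i k; simp [ω]
      have ew2 : ∀ (i : Fin p) k, ω (Fin.natAdd q i) (Fin.natAdd q k) = β i k := by
        intro i k; simp [ω]
      have hω : ω ≠ 0 := by
        intro h0
        apply hα
        ext i j
        rw [← ew1, h0]; rfl
      have hωx : ‖ω.map (Int.cast : ℤ → ℝ) * x‖ ≤ K * D := by
        rw [split_aux ω ξ θ x h1 h2]
        refine (nmul_aux _ _).trans ?_
        gcongr
        · linarith
        · rw [Matrix.norm_le_iff hD0]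
          intro i j
          refine Fin.addCases (fun i => ?_) (fun i => ?_) i
          · simpa [Matrix.mul_apply, ew0] using hD0
          · refine le_trans (le_of_eq ?_) (Matrix.norm_entry_le_entrywise_sup_norm
              ((α.map (Int.cast : ℤ → ℝ)) * ξ + β.map (Int.cast : ℤ → ℝ)) (i := i) (j := j))
            simp [Matrix.mul_apply, ew1, ew2]
      have hβ : ‖β.map (Int.cast : ℤ → ℝ)‖ ≤ L * a := by
        have e1 : β.map (Int.cast : ℤ → ℝ) =
          ((α.map (Int.cast : ℤ → ℝ)) * ξ + β.map (Int.cast : ℤ → ℝ))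
            - (α.map (Int.cast : ℤ → ℝ)) * ξ := by abel
        rw [e1]
        refine (norm_sub_le _ _).trans ?_
        have := nmul_aux (α.map (Int.cast : ℤ → ℝ)) ξ
        calc _ ≤ D + (q * ‖ξ‖) * a := add_le_add le_rfl this
          _ ≤ a + (q * ‖ξ‖) * a := by linarith
          _ = _ := by rw [hL]; ring
      have hωn : ‖ω.map (Int.cast : ℤ → ℝ)‖ ≤ L * a := by
        rw [Matrix.norm_le_iff (by positivity)]
        intro i j
        refine Fin.addCases (fun i => ?_) (fun i => ?_) i
        · simp only [Matrix.map_apply, ew0]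
          simp; positivity
        · refine Fin.addCases (fun j => ?_) (fun j => ?_) j
          · simp only [Matrix.map_apply, ew1]
            have := Matrix.norm_entry_le_entrywise_sup_norm (α.map (Int.cast : ℤ → ℝ)) (i := i) (j := j)
            rw [Matrix.map_apply] at this
            refine this.trans ?_
            nlinarith
          · simp only [Matrix.map_apply, ew2]
            have := Matrix.norm_entry_le_entrywise_sup_norm (β.map (Int.cast : ℤ → ℝ)) (i := i) (j := j)
            rw [Matrix.map_apply] at this
            exact this.trans hβ
      have h3 : c < (K * D) ^ p * (L * a) ^ q := by
        refine (H ω hω).trans_le ?_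
        gcongr
      have h4 : e ≤ (D * t) ^ p := by
        rw [he, div_le_iff₀ (by positivity)]
        refine h3.le.trans (le_of_eq ?_)
        rw [mul_pow, mul_pow, mul_pow, htp]; ring
      exact le_of_pow_le_pow_left₀ (by omega) (by positivity) (hmp.trans h4)
  calc m / 2 < m := by linarith
    _ = m / t * t := by field_simp
    _ ≤ dval ξ α * t := by gcongr

lemma bwd_aux (p q : ℕ) (hp : 1 ≤ p) (hq : 1 ≤ q)
    (ξ : Matrix (Fin q) (Fin p) ℝ) (θ : Matrix (Fin p) (Fin p) ℝ) (hθ : θ.det ≠ 0)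
    (x : Matrix (Fin (q + p)) (Fin p) ℝ)
    (h1 : ∀ i j, x (Fin.castAdd p i) j = (ξ * θ) i j)
    (h2 : ∀ i j, x (Fin.natAdd q i) j = θ i j)
    (c : ℝ) (hc : 0 < c)
    (H : ∀ α : Matrix (Fin p) (Fin q) ℤ, α ≠ 0 →
        c < dval ξ α * ‖α.map (Int.cast : ℤ → ℝ)‖ ^ ((q : ℝ) / p)) :
    ∃ c > (0 : ℝ), ∀ ω : Matrix (Fin (q + p)) (Fin (q + p)) ℤ, ω ≠ 0 →
        c < ‖(ω.map (Int.cast : ℤ → ℝ)) * x‖ ^ p * ‖ω.map (Int.cast : ℤ → ℝ)‖ ^ q := by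
  set K : ℝ := p * ‖θ⁻¹‖ + 1 with hK
  have hK0 : 0 < K := by positivity
  set m : ℝ := min c 1 with hm
  have hm0 : 0 < m := by positivity
  refine ⟨(m / K) ^ p / 2, by positivity, fun ω hω => ?_⟩
  have hw1 := one_le_aux ω hω
  set w := ‖ω.map (Int.cast : ℤ → ℝ)‖ with hw
  set A := ω.submatrix id (Fin.castAdd p) with hA
  set B := ω.submatrix id (Fin.natAdd q) with hB
  set D := ‖A.map (Int.cast : ℤ → ℝ) * ξ + B.map (Int.cast : ℤ → ℝ)‖ with hD
  have hD0 : 0 ≤ D := norm_nonneg _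
  set t := w ^ ((q : ℝ) / p) with ht
  have ht1 : 1 ≤ t := Real.one_le_rpow hw1 (by positivity)
  have ht0 : 0 < t := by linarith
  have htp : t ^ p = w ^ q := by
    rw [ht, ← Real.rpow_natCast, ← Real.rpow_mul (by linarith), div_mul_cancel₀ _ (by positivity),
      Real.rpow_natCast]
  have hDx : D ≤ K * ‖ω.map (Int.cast : ℤ → ℝ) * x‖ := by
    have e1 : A.map (Int.cast : ℤ → ℝ) * ξ + B.map (Int.cast : ℤ → ℝ)
        = (ω.map (Int.cast : ℤ → ℝ) * x) * θ⁻¹ := by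
      rw [split_aux ω ξ θ x h1 h2, Matrix.mul_assoc, Matrix.mul_nonsing_inv _ (by simpa using hθ),
        Matrix.mul_one]
    rw [hD, e1]
    refine (nmul_aux _ _).trans ?_
    gcongr
    linarith
  have key : m ≤ D * t := by
    by_cases hA0 : A = 0
    · have hB0 : B ≠ 0 := by
        intro hB0
        apply hω
        ext i j
        refine Fin.addCases (fun j => ?_) (fun j => ?_) j
        · exact congrFun (congrFun hA0 i) j
        · exact congrFun (congrFun hB0 i) j
      have : 1 ≤ D := by
        have e2 : A.map (Int.cast : ℤ → ℝ) * ξ + B.map (Int.cast : ℤ → ℝ)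
          = B.map (Int.cast : ℤ → ℝ) := by
          rw [hA0]; simp
        rw [hD, e2]; exact one_le_aux B hB0
      calc m ≤ 1 := min_le_right _ _
        _ ≤ D * t := by nlinarith
    · have : ∃ i j, A i j ≠ 0 := by
        by_contra! h
        exact hA0 (by ext i j; simpa using h i j)
      obtain ⟨i, j, hij⟩ := this
      let α : Matrix (Fin p) (Fin q) ℤ := fun _ k => A i k
      let β : Matrix (Fin p) (Fin p) ℤ := fun _ k => B i k
      have hα : α ≠ 0 := fun h => hij (congrFun (congrFun h ⟨0, hp⟩) j)
      have hd : dval ξ α ≤ D := by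
        refine (dval_le_aux ξ α β).trans ?_
        rw [Matrix.norm_le_iff hD0]
        intro k l
        refine le_trans (le_of_eq ?_) (Matrix.norm_entry_le_entrywise_sup_norm
          (A.map (Int.cast : ℤ → ℝ) * ξ + B.map (Int.cast : ℤ → ℝ)) (i := i) (j := l))
        simp only [Matrix.add_apply, Matrix.mul_apply, Matrix.map_apply]
        rfl
      have hn : ‖α.map (Int.cast : ℤ → ℝ)‖ ≤ w := by
        rw [Matrix.norm_le_iff (by positivity)]
        intro k l
        exact Matrix.norm_entry_le_entrywise_sup_norm
          (ω.map (Int.cast : ℤ → ℝ)) (i := i) (j := Fin.castAdd p l)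
      calc m ≤ c := min_le_left _ _
        _ ≤ _ := (H α hα).le
        _ ≤ D * t := by rw [ht]; gcongr
  have : m / K ≤ ‖ω.map (Int.cast : ℤ → ℝ) * x‖ * t := by
    rw [div_le_iff₀ hK0]
    nlinarith
  calc (m / K) ^ p / 2 < (m / K) ^ p := by
        have : 0 < (m / K) ^ p := by positivity
        linarith
    _ ≤ (‖ω.map (Int.cast : ℤ → ℝ) * x‖ * t) ^ p := by gcongr
    _ = _ := by rw [mul_pow, htp]

/-- **Proposition 4.6.** If `x` is the `n×p` matrix formed by stacking `ξθ` on top of `θ`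
(with `θ` invertible), then `x` is projectively badly approximable (there is `c > 0` with
`‖ωx‖^p ‖ω‖^{n−p} > c` for every nonzero `ω ∈ M(n,ℤ)`) if and only if `ξ` is badly
approximable (the infimum over nonzero `p×q` integer matrices `α` of
`d(α)·‖α‖^{(n−p)/p}` is positive). -/
theorem projectivelyBadlyApprox_iff_badlyApprox
    (n p q : ℕ) (hn : 2 ≤ n) (hp : 1 ≤ p) (hpn : p ≤ n - 1) (hq : q = n - p)
    (ξ : Matrix (Fin q) (Fin p) ℝ) (θ : Matrix (Fin p) (Fin p) ℝ) (hθ : θ.det ≠ 0)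
    (x : Matrix (Fin n) (Fin p) ℝ)
    (hxtop : ∀ (i : Fin q) (j : Fin p),
      x (Fin.cast (by omega) (Fin.castAdd p i)) j = (ξ * θ) i j)
    (hxbot : ∀ (i : Fin p) (j : Fin p),
      x (Fin.cast (by omega) (Fin.natAdd q i)) j = θ i j) :
    (∃ c > (0 : ℝ), ∀ ω : Matrix (Fin n) (Fin n) ℤ, ω ≠ 0 →
        c < ‖(ω.map (Int.cast : ℤ → ℝ)) * x‖ ^ (p : ℝ) *
            ‖ω.map (Int.cast : ℤ → ℝ)‖ ^ ((n : ℝ) - p)) ↔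
    (∃ c > (0 : ℝ), ∀ α : Matrix (Fin p) (Fin q) ℤ, α ≠ 0 →
        c < dval ξ α * ‖α.map (Int.cast : ℤ → ℝ)‖ ^ (((n : ℝ) - p) / p)) := by
  obtain rfl : n = q + p := by omega
  have e : ((q + p : ℕ) : ℝ) - p = q := by push_cast; ring
  rw [e]
  simp only [Real.rpow_natCast]
  constructor
  · rintro ⟨c, hc, H⟩
    exact fwd_aux p q hp (by omega) ξ θ x hxtop hxbot c hc H
  · rintro ⟨c, hc, H⟩
    exact bwd_aux p q hp (by omega) ξ θ hθ x hxtop hxbot c hc H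
end

section
/- Let n ≥ 2, 1 ≤ p ≤ n−1, let x = (x_1,…,x_p) ∈ ℝ^{(n,p)} with x_1,…,x_p linearly independent vectors in ℝ^n, and let B be a bounded subset of ℝ^{(n,p)}. Then there exists a constant C > 0 such that for every positive integer q, the number of matrices γ ∈ M(n,ℤ) with ||γ|| ≤ q and γx ∈ B is at most C q^{n(n−p)}. -/
open Matrix

attribute [local instance] Matrix.normedAddCommGroup

open Matrix in
theorem aux_rows (n p : ℕ) (x : Matrix (Fin n) (Fin p) ℝ)
    (hx : LinearIndependent ℝ (fun j i => x i j : Fin p → Fin n → ℝ)) :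
    ∃ s : Finset (Fin n), s.card = p ∧ LinearIndependent ℝ (fun k : s => x k) := by
  obtain ⟨κ, a, ha, hs, hl⟩ := exists_linearIndependent' ℝ (fun i => x i)
  have : Fintype κ := Fintype.ofInjective a ha
  have h1 : x.rank = p := by
    rw [Matrix.rank_eq_finrank_span_cols]
    have := finrank_span_eq_card hx
    rw [Fintype.card_fin] at this
    exact this
  have h2 : Fintype.card κ = p := by
    rw [← finrank_span_eq_card hl, hs]
    rw [Matrix.rank_eq_finrank_span_row] at h1
    exact h1
  classical
  refine ⟨Finset.univ.image a, ?_, ?_⟩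
  · rw [Finset.card_image_of_injective _ ha, Finset.card_univ, h2]
  · have hex : ∀ k : ↥(Finset.univ.image a), ∃ c, a c = k := fun k => by
      obtain ⟨c, -, hc⟩ := Finset.mem_image.mp k.2
      exact ⟨c, hc⟩
    choose e he using hex
    have hi : Function.Injective e := fun k l h => by
      apply Subtype.ext
      rw [← he k, ← he l, h]
    have := hl.comp e hi
    have h3 : (((fun i => x i) ∘ a) ∘ e) = fun k : ↥(Finset.univ.image a) => x k := by
      funext k
      exact congrArg (fun i => x i) (he k)
    rw [h3] at this
    exact this

theorem aux_bound (n p : ℕ) (x : Matrix (Fin n) (Fin p) ℝ) (s : Finset (Fin n))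
    (hs : LinearIndependent ℝ (fun k : s => x k)) :
    ∃ K : ℝ, 0 ≤ K ∧ ∀ d : Fin n → ℝ, (∀ i, i ∉ s → d i = 0) → ∀ R : ℝ, 0 ≤ R →
      (∀ j, |∑ i, d i * x i j| ≤ R) → ∀ i, |d i| ≤ K * R := by
  let L : (s → ℝ) →ₗ[ℝ] (Fin p → ℝ) := Fintype.linearCombination ℝ (fun k : s => x k)
  have hL : LinearMap.ker L = ⊥ := by
    rw [LinearMap.ker_eq_bot]
    exact hs.fintypeLinearCombination_injective
  obtain ⟨K, -, hK⟩ := L.exists_antilipschitzWith hL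
  refine ⟨K, K.2, fun d hd R hR hb i => ?_⟩
  by_cases hi : i ∈ s
  · have h1 : ‖(fun k : s => d k)‖ ≤ K * ‖L (fun k : s => d k)‖ := by
      have := hK.le_mul_dist (fun k : s => d k) 0
      simpa using this
    have h2 : ‖L (fun k : s => d k)‖ ≤ R := by
      rw [pi_norm_le_iff_of_nonneg hR]
      intro j
      have : L (fun k : s => d k) j = ∑ i, d i * x i j := by
        simp only [L, Fintype.linearCombination_apply, Finset.sum_apply, Pi.smul_apply, smul_eq_mul]
        rw [Finset.sum_coe_sort s (fun i => d i * x i j)]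
        exact Finset.sum_subset (Finset.subset_univ s) (fun i _ h => by rw [hd i h, zero_mul])
      rw [this]; exact hb j
    have h3 := norm_le_pi_norm (fun k : s => d k) ⟨i, hi⟩
    have h4 := mul_le_mul_of_nonneg_left h2 K.2
    exact h3.trans (h1.trans h4)
  · rw [hd i hi, abs_zero]; exact mul_nonneg K.2 hR

/-- **Counting estimate (5.1).** If `x ∈ ℝ^{(n,p)}` has linearly independent columns and
`B` is a bounded subset of `ℝ^{(n,p)}`, then there is `C > 0` such that for every positive
integer `q` the set of integer matrices `γ` with `‖γ‖ ≤ q` and `γx ∈ B` is finite, of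
cardinality at most `C·q^{n(n−p)}`. -/
theorem counting_estimate
    (n p : ℕ) (hn : 2 ≤ n) (hp : 1 ≤ p) (hpn : p ≤ n - 1)
    (x : Matrix (Fin n) (Fin p) ℝ)
    (hx : LinearIndependent ℝ (fun j i => x i j : Fin p → Fin n → ℝ))
    (B : Set (Matrix (Fin n) (Fin p) ℝ)) (hB : Bornology.IsBounded B) :
    ∃ C : ℝ, 0 < C ∧ ∀ q : ℕ, 0 < q →
      {γ : Matrix (Fin n) (Fin n) ℤ | ‖γ.map (Int.cast : ℤ → ℝ)‖ ≤ (q : ℝ) ∧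
        (γ.map (Int.cast : ℤ → ℝ)) * x ∈ B}.Finite ∧
      (Nat.card {γ : Matrix (Fin n) (Fin n) ℤ | ‖γ.map (Int.cast : ℤ → ℝ)‖ ≤ (q : ℝ) ∧
        (γ.map (Int.cast : ℤ → ℝ)) * x ∈ B} : ℝ) ≤ C * (q : ℝ) ^ (n * (n - p)) := by
  obtain ⟨s, hsc, hs⟩ := aux_rows n p x hx
  obtain ⟨K, hK0, hK⟩ := aux_bound n p x s hs
  obtain ⟨R, hR0, hR⟩ := hB.exists_pos_norm_le
  obtain ⟨M, hM⟩ := exists_nat_gt (K * (R + R))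
  have hM0 : 0 < M := by
    have : (0:ℝ) < M := lt_of_le_of_lt (by positivity) hM
    exact_mod_cast this
  have : NeZero M := ⟨hM0.ne'⟩
  refine ⟨3 ^ (n * (n - p)) * M ^ (n * p), by positivity, fun q hq => ?_⟩
  set S := {γ : Matrix (Fin n) (Fin n) ℤ | ‖γ.map (Int.cast : ℤ → ℝ)‖ ≤ (q : ℝ) ∧
        (γ.map (Int.cast : ℤ → ℝ)) * x ∈ B} with hS
  have hent : ∀ γ ∈ S, ∀ i j, γ i j ∈ Finset.Icc (-(q:ℤ)) q := by
    intro γ hγ i j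
    have h := (Matrix.norm_le_iff (by positivity)).mp hγ.1 i j
    rw [Matrix.map_apply, Real.norm_eq_abs] at h
    rw [Finset.mem_Icc, ← abs_le]
    exact_mod_cast h
  let T := (Fin n → {i // i ∉ s} → Finset.Icc (-(q:ℤ)) q) × (Fin n → s → ZMod M)
  let φ : S → T := fun γ => (fun i j => ⟨γ.1 i j, hent γ.1 γ.2 i j⟩, fun i j => (γ.1 i j : ZMod M))
  have hφ : Function.Injective φ := by
    rintro ⟨γ, hγ⟩ ⟨δ, hδ⟩ h
    apply Subtype.ext
    have h1 : ∀ i j, j ∉ s → γ i j = δ i j := fun i j hj =>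
      congrArg Subtype.val (congrFun (congrFun (congrArg Prod.fst h) i) ⟨j, hj⟩)
    have h2 : ∀ i j, j ∈ s → (γ i j : ZMod M) = δ i j := fun i j hj =>
      congrFun (congrFun (congrArg Prod.snd h) i) ⟨j, hj⟩
    ext i j
    change γ i j = δ i j
    by_cases hj : j ∈ s
    · have hb := hK (fun k => (γ i k : ℝ) - δ i k) (fun k hk => by rw [h1 i k hk, sub_self])
        (R + R) (by positivity) (fun l => by
          have e1 := (Matrix.norm_le_iff hR0.le).mp (hR _ hγ.2) i l
          have e2 := (Matrix.norm_le_iff hR0.le).mp (hR _ hδ.2) i l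
          have : ∑ k, ((γ i k : ℝ) - δ i k) * x k l =
            (γ.map (Int.cast : ℤ → ℝ) * x) i l - (δ.map (Int.cast : ℤ → ℝ) * x) i l := by
            simp [Matrix.mul_apply, sub_mul]
          rw [this]
          exact (norm_sub_le _ _).trans (add_le_add e1 e2)) j
      have hlt : |γ i j - δ i j| < (M : ℤ) := by
        have := hb.trans_lt hM
        exact_mod_cast this
      have hd : (M : ℤ) ∣ γ i j - δ i j := by
        rw [← ZMod.intCast_zmod_eq_zero_iff_dvd]
        push_cast
        rw [h2 i j hj, sub_self]
      have := Int.eq_zero_of_abs_lt_dvd hd hlt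
      omega
    · exact h1 i j hj
  have hfin : Finite S := Finite.of_injective φ hφ
  refine ⟨hfin, ?_⟩
  have hc : Nat.card S ≤ Nat.card T := Nat.card_le_card_of_injective φ hφ
  have hT : Nat.card T = (2 * q + 1) ^ (n * (n - p)) * M ^ (n * p) := by
    have h1 : Fintype.card {i // i ∉ s} = n - p := by
      rw [Fintype.card_subtype_compl]; simp [hsc]
    have h2 : ((q:ℤ) + 1 - -(q:ℤ)).toNat = 2 * q + 1 := by omega
    rw [Nat.card_eq_fintype_card]
    simp only [T, Fintype.card_prod, Fintype.card_fun, h1, Fintype.card_coe, Int.card_Icc, h2, hsc,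
      ZMod.card, Fintype.card_fin]
    rw [← pow_mul, ← pow_mul, mul_comm p n, mul_comm (n - p) n]
  have hq1 : (1:ℝ) ≤ q := by exact_mod_cast hq
  calc (Nat.card S : ℝ) ≤ (Nat.card T : ℝ) := by exact_mod_cast hc
    _ = (2 * (q:ℝ) + 1) ^ (n * (n - p)) * M ^ (n * p) := by rw [hT]; push_cast; rfl
    _ ≤ (3 * (q:ℝ)) ^ (n * (n - p)) * M ^ (n * p) := by
      gcongr
      linarith
    _ = _ := by rw [mul_pow]; ring
end

section
/- Let d ≥ 1 and let E be a compact subset of ℝ^d such that the difference set E − E = {x − y : x, y ∈ E} contains no nonzero point of ℤ^d. Then the Lebesgue measure of E is strictly less than 1. -/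
open MeasureTheory

lemma aux_blichfeldt (d : ℕ) (U : Set (Fin d → ℝ)) (hU : IsOpen U) (h : 1 < volume U) :
    ∃ x ∈ U, ∃ y ∈ U, ∃ n : Fin d → ℤ, n ≠ 0 ∧ x - y = fun i => (n i : ℝ) := by
  let b := Pi.basisFun ℝ (Fin d)
  have fund := ZSpan.isAddFundamentalDomain' b (volume : Measure (Fin d → ℝ))
  have hv : volume (ZSpan.fundamentalDomain b) = 1 := by
    rw [ZSpan.fundamentalDomain_pi_basisFun, volume_pi_pi]; simp
  have : Countable (Submodule.span ℤ (Set.range b)).toAddSubgroup :=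
    inferInstanceAs (Countable (Submodule.span ℤ (Set.range b)))
  obtain ⟨p, q, hpq, hd⟩ := exists_pair_mem_lattice_not_disjoint_vadd fund
    hU.measurableSet.nullMeasurableSet (by rw [hv]; exact h)
  obtain ⟨_, ⟨v, hv, rfl⟩, w, hw, hvw⟩ := Set.not_disjoint_iff.mp hd
  have hvw' : (q : Fin d → ℝ) + w = p + v := hvw
  have hmem : (q : Fin d → ℝ) - p ∈ Submodule.span ℤ (Set.range b) := sub_mem q.2 p.2
  rw [b.mem_span_iff_repr_mem ℤ] at hmem
  choose n hn using hmem
  have hn' : ∀ i, (n i : ℝ) = (q : Fin d → ℝ) i - (p : Fin d → ℝ) i := by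
    intro i; simpa [b] using hn i
  have e : v - w = (q : Fin d → ℝ) - p := by
    rw [sub_eq_sub_iff_add_eq_add, add_comm v, ← hvw']
  refine ⟨v, hv, w, hw, n, ?_, ?_⟩
  · rintro rfl
    apply hpq
    apply Subtype.ext
    funext i
    have := hn' i
    simp at this
    linarith
  · rw [e]; funext i; simp [hn' i]

/-- If `E ⊆ ℝ^d` is compact and its difference set `E − E` contains no nonzero point of
`ℤ^d`, then the Lebesgue measure of `E` is strictly less than `1`. -/
theorem measure_lt_one_of_no_integral_difference
    (d : ℕ) (hd : 1 ≤ d) (E : Set (Fin d → ℝ)) (hE : IsCompact E)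
    (hdiff : ∀ x ∈ E, ∀ y ∈ E, (∀ i, ∃ k : ℤ, x i - y i = (k : ℝ)) → x = y) :
    volume E < 1 := by
  by_contra hlt
  rw [not_lt] at hlt
  have : Nonempty (Fin d) := ⟨⟨0, hd⟩⟩
  have hne : E.Nonempty := by
    rw [Set.nonempty_iff_ne_empty]; rintro rfl; simp at hlt
  let Z : Set (Fin d → ℝ) := (fun (n : Fin d → ℤ) i => (n i : ℝ)) '' {n | n ≠ 0}
  have hemb : Topology.IsClosedEmbedding (fun (n : Fin d → ℤ) (i : Fin d) => (n i : ℝ)) :=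
    Topology.IsClosedEmbedding.piMap (fun _ => Int.isClosedEmbedding_coe_real)
  have hZ : IsClosed Z := hemb.isClosedMap _ (isClosed_discrete _)
  let K : Set (Fin d → ℝ) := (fun p : (Fin d → ℝ) × (Fin d → ℝ) => p.1 - p.2) '' (E ×ˢ E)
  have hK : IsCompact K := (hE.prod hE).image (by fun_prop)
  have hdis : Disjoint K Z := by
    rw [Set.disjoint_left]
    rintro _ ⟨⟨x, y⟩, ⟨hx, hy⟩, rfl⟩ ⟨n, hn, h⟩
    have h' : ∀ i, (n i : ℝ) = x i - y i := fun i => congrFun h i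
    have := hdiff x hx y hy (fun i => ⟨n i, (h' i).symm⟩)
    apply hn
    funext i
    have := h' i
    subst x
    simpa using this
  obtain ⟨δ, hδ, hdis'⟩ := hdis.exists_thickenings hK hZ
  let U := Metric.thickening (δ / 2) E
  have hUo : IsOpen U := Metric.isOpen_thickening
  have hEU : E ⊆ U := Metric.self_subset_thickening (by positivity) E
  have hdiffne : (U \ E).Nonempty := by
    rw [Set.sdiff_nonempty]
    intro hUE
    have heq : U = E := hUE.antisymm hEU
    have hcl : IsClopen E := ⟨hE.isClosed, heq ▸ hUo⟩
    have := hcl.eq_univ hne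
    exact noncompact_univ (Fin d → ℝ) (this ▸ hE)
  have hpos : 0 < volume (U \ E) := (hUo.sdiff hE.isClosed).measure_pos volume hdiffne
  have hU1 : 1 < volume U := by
    rw [← measure_sdiff_add_inter U hE.measurableSet, Set.inter_eq_right.mpr hEU, add_comm]
    refine hlt.trans_lt ?_
    exact ENNReal.lt_add_right hE.measure_lt_top.ne hpos.ne'
  obtain ⟨x, hx, y, hy, n, hn, hxy⟩ := aux_blichfeldt d U hUo hU1
  obtain ⟨x', hx', hxd⟩ := Metric.mem_thickening_iff.mp hx
  obtain ⟨y', hy', hyd⟩ := Metric.mem_thickening_iff.mp hy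
  suffices hin : x - y ∈ Metric.thickening δ K from
    Set.disjoint_left.mp hdis' hin (Metric.self_subset_thickening hδ Z ⟨n, hn, hxy.symm⟩)
  rw [Metric.mem_thickening_iff]
  refine ⟨x' - y', ⟨(x', y'), ⟨hx', hy'⟩, rfl⟩, ?_⟩
  calc dist (x - y) (x' - y') ≤ dist x x' + dist y y' := dist_sub_sub_le _ _ _ _
    _ < δ := by linarith
end
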